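/- arXiv:2012.08875 — 2 statements merged into one kernel-verified Lean document; each statement's English description precedes it below -/
import Mathlib

section
/- For every η with 0 < η < 1 there exists α_0 > 0 such that for every 0 < α ≤ α_0 there exists ε_0 > 0 such that for every 0 < ε ≤ ε_0 there exists n_0 such that for all n ≥ n_0 the following holds: every 2-edge-coloured (1−ε, α)-dense 4-graph H on n vertices contains a red tightly connected matching and a blue tightly connected matching that are vertex-disjoint and whose union covers all but at most 3ηn of the vertices of H. -/
open Finset

/-- `degOn k H S W` is `d_H(S, W)`: the number of `(k - |S|)`-element subsets `e` of `W`
with `e ∪ S` an edge of the `k`-graph `H`. -/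
def degOn {V : Type*} [DecidableEq V] (k : ℕ) (H : Finset (Finset V)) (S W : Finset V) : ℕ :=
  ((W.powersetCard (k - S.card)).filter (fun e => e ∪ S ∈ H)).card

/-- `degT k H S` is `d_H(S) = d_H(S, V)`. -/
def degT {V : Type*} [Fintype V] [DecidableEq V] (k : ℕ) (H : Finset (Finset V))
    (S : Finset V) : ℕ :=
  degOn k H S Finset.univ

/-- A `k`-graph `H` on the vertex set `V` is `(μ, α)`-dense. -/
def IsDense {V : Type*} [Fintype V] [DecidableEq V] (k : ℕ) (H : Finset (Finset V))
    (μ α : ℝ) : Prop :=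
  ∀ i : ℕ, 1 ≤ i → i ≤ k - 1 →
    (({S : Finset V | S.card = i ∧
        (degT k H S : ℝ) < μ * ((Fintype.card V).choose (k - i))}.ncard : ℝ)
      ≤ α * ((Fintype.card V).choose i)) ∧
    ∀ S : Finset V, S.card = i →
      (degT k H S : ℝ) < μ * ((Fintype.card V).choose (k - i)) → degT k H S = 0

/-- Two edges `f, f'` of a `k`-graph `Hc` are tightly connected: there is a walk of edges,
consecutive ones sharing `k - 1` vertices. -/
def TightConn {V : Type*} [DecidableEq V] (k : ℕ) (Hc : Finset (Finset V)) (f f' : Finset V) : Prop :=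
  ∃ (t : ℕ) (e : ℕ → Finset V), e 0 = f ∧ e t = f' ∧ (∀ i ≤ t, e i ∈ Hc) ∧
    ∀ i < t, ((e i) ∩ (e (i + 1))).card = k - 1

/-- `C` is a tightly connected subgraph of the `k`-graph `Hc`. -/
def IsTCSub {V : Type*} [DecidableEq V] (k : ℕ) (Hc C : Finset (Finset V)) : Prop :=
  C ⊆ Hc ∧ ∀ f ∈ C, ∀ f' ∈ C, TightConn k Hc f f'

/-- `C` is a tight component (a maximal tightly connected subgraph) of the `k`-graph `Hc`. -/
def IsTightComponent {V : Type*} [DecidableEq V] (k : ℕ) (Hc C : Finset (Finset V)) : Prop :=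
  IsTCSub k Hc C ∧ ∀ C' : Finset (Finset V), IsTCSub k Hc C' → C ⊆ C' → C' = C

/-- The shadow of `H` consisting of all `r`-element sets contained in some edge of `H`. -/
def shadowTo {V : Type*} [Fintype V] [DecidableEq V] (r : ℕ) (H : Finset (Finset V)) :
    Finset (Finset V) :=
  ((Finset.univ : Finset V).powersetCard r).filter (fun e => ∃ f ∈ H, e ⊆ f)

/-- An `ε`-blueprint for a 2-edge-coloured `k`-graph `H` (with colouring `cH`, `true` = red):
a 2-edge-coloured `(k-2)`-graph together with the assignment `comp` of monochromatic tight
components, satisfying (BP1) and (BP2). -/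
structure Blueprint (k : ℕ) {V : Type*} [Fintype V] [DecidableEq V]
    (H : Finset (Finset V)) (cH : Finset V → Bool) (ε : ℝ) where
  verts : Finset V
  edges : Finset (Finset V)
  col : Finset V → Bool
  comp : Finset V → Finset (Finset V)
  edges_card : ∀ e ∈ edges, e.card = k - 2
  edges_sub : ∀ e ∈ edges, e ⊆ verts
  comp_is : ∀ e ∈ edges, IsTightComponent k (H.filter (fun f => cH f = col e)) (comp e)
  comp_deg : ∀ e ∈ edges,
    (1 - ε) * (Fintype.card V : ℝ) ≤ (degT (k - 1) (shadowTo (k - 1) (comp e)) e : ℝ)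
  comp_agree : ∀ e ∈ edges, ∀ e' ∈ edges, col e = col e' → (e ∩ e').card = k - 3 →
    comp e = comp e'

/-- For a subset `G'` of the edges of a blueprint `G`, the `k`-graph `(G')⁺`: all edges of
`⋃_{e ∈ G'} H(e)` containing some edge of `G'`. -/
def Blueprint.plus {k : ℕ} {V : Type*} [Fintype V] [DecidableEq V]
    {H : Finset (Finset V)} {cH : Finset V → Bool} {ε : ℝ}
    (G : Blueprint k H cH ε) (G' : Finset (Finset V)) : Finset (Finset V) :=
  (G'.biUnion (fun e => G.comp e)).filter (fun f => ∃ e ∈ G', e ⊆ f)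

/-- `M` is a matching: a set of pairwise disjoint edges. -/
def IsMatching {V : Type*} [DecidableEq V] (M : Finset (Finset V)) : Prop :=
  ∀ e ∈ M, ∀ f ∈ M, e ≠ f → Disjoint e f

/-- `M` is a tightly connected matching in the `k`-graph `Hc`. -/
def IsTCMatching {V : Type*} [DecidableEq V] (k : ℕ) (Hc M : Finset (Finset V)) : Prop :=
  M ⊆ Hc ∧ IsMatching M ∧ ∀ e ∈ M, ∀ f ∈ M, TightConn k Hc e f

namespace TCM

/-- Tight adjacency graph on edges of the same colour. -/
def TG {V : Type*} [DecidableEq V] (H : Finset (Finset V)) (cH : Finset V → Bool) :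
    SimpleGraph (Finset V) where
  Adj f g := f ≠ g ∧ f ∈ H ∧ g ∈ H ∧ cH f = cH g ∧ (f ∩ g).card = 3
  symm := ⟨by
    rintro f g ⟨h1, h2, h3, h4, h5⟩
    exact ⟨h1.symm, h3, h2, h4.symm, by rwa [Finset.inter_comm]⟩⟩
  loopless := ⟨fun f h => h.1 rfl⟩

/-- The tight component of an edge. -/
def K {V : Type*} [DecidableEq V] (H : Finset (Finset V)) (cH : Finset V → Bool)
    (f : Finset V) : (TG H cH).ConnectedComponent := (TG H cH).connectedComponentMk f

theorem tightConn_of_K {V : Type*} [DecidableEq V] {H : Finset (Finset V)}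
    {cH : Finset V → Bool} {f g : Finset V} {c : Bool} (hf : f ∈ H) (hfc : cH f = c)
    (h : K H cH f = K H cH g) :
    TightConn 4 (H.filter (fun f => cH f = c)) f g := by
  have hr : (TG H cH).Reachable f g := SimpleGraph.ConnectedComponent.exact h
  obtain ⟨p⟩ := hr
  refine ⟨p.length, p.getVert, by simp, by simp, ?_, ?_⟩
  · intro i
    induction i with
    | zero => intro _; simp [hf, hfc]
    | succ i ih =>
      intro hi
      have h1 := ih (by omega)
      have h2 := p.adj_getVert_succ (i := i) (by omega)
      rw [Finset.mem_filter] at h1 ⊢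
      exact ⟨h2.2.2.1, by rw [← h2.2.2.2.1]; exact h1.2⟩
  · intro i hi
    exact (p.adj_getVert_succ hi).2.2.2.2

theorem K_eq_of_triple {V : Type*} [DecidableEq V] {H : Finset (Finset V)}
    {cH : Finset V → Bool} (hH4 : ∀ e ∈ H, e.card = 4) {t f g : Finset V} (ht : t.card = 3)
    (hf : f ∈ H) (hg : g ∈ H) (htf : t ⊆ f) (htg : t ⊆ g) (hc : cH f = cH g) :
    K H cH f = K H cH g := by
  by_cases hfg : f = g
  · rw [hfg]
  · apply SimpleGraph.ConnectedComponent.sound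
    apply SimpleGraph.Adj.reachable
    refine ⟨hfg, hf, hg, hc, ?_⟩
    have h1 : 3 ≤ (f ∩ g).card := ht ▸ Finset.card_le_card (Finset.subset_inter htf htg)
    have h2 : (f ∩ g).card < 4 := by
      rw [← hH4 f hf]
      apply Finset.card_lt_card
      refine ⟨Finset.inter_subset_left, fun h => hfg ?_⟩
      apply Finset.eq_of_subset_of_card_le
      · exact h.trans Finset.inter_subset_right
      · rw [hH4 f hf, hH4 g hg]
    omega

theorem johnson {V : Type*} [DecidableEq V] {H : Finset (Finset V)}
    {cH : Finset V → Bool} (hH4 : ∀ e ∈ H, e.card = 4) {Q : Finset V} {c : Bool}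
    (h : ∀ f ⊆ Q, f.card = 4 → f ∈ H ∧ cH f = c) :
    ∀ (m : ℕ) (f g : Finset V), f ⊆ Q → g ⊆ Q → f.card = 4 → g.card = 4 →
      (f \ g).card = m → K H cH f = K H cH g := by
  intro m
  induction m with
  | zero =>
    intro f g hf hg hf4 hg4 hm
    rw [Finset.card_eq_zero, Finset.sdiff_eq_empty_iff_subset] at hm
    rw [Finset.eq_of_subset_of_card_le hm (by omega)]
  | succ m ih =>
    intro f g hf hg hf4 hg4 hm
    obtain ⟨x, hx⟩ : (f \ g).Nonempty := Finset.card_pos.1 (by omega)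
    have hgf : (g \ f).card = (f \ g).card := Finset.card_sdiff_comm (by omega)
    obtain ⟨y, hy⟩ : (g \ f).Nonempty := Finset.card_pos.1 (by omega)
    rw [Finset.mem_sdiff] at hx hy
    have hyf : y ∉ f.erase x := fun h => hy.2 (Finset.mem_of_mem_erase h)
    have hc' : (insert y (f.erase x)).card = 4 := by
      rw [Finset.card_insert_of_notMem hyf, Finset.card_erase_of_mem hx.1]; omega
    have hsub : insert y (f.erase x) ⊆ Q := by
      intro z hz
      rw [Finset.mem_insert] at hz
      rcases hz with rfl | hz
      · exact hg hy.1
      · exact hf (Finset.mem_of_mem_erase hz)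
    have e1 : K H cH f = K H cH (insert y (f.erase x)) := by
      apply K_eq_of_triple hH4 (t := f.erase x)
      · rw [Finset.card_erase_of_mem hx.1]; omega
      · exact (h f hf hf4).1
      · exact (h _ hsub hc').1
      · exact Finset.erase_subset _ _
      · exact Finset.subset_insert _ _
      · rw [(h f hf hf4).2, (h _ hsub hc').2]
    rw [e1]
    apply ih _ _ hsub hg hc' hg4
    have : insert y (f.erase x) \ g = (f \ g).erase x := by
      ext z
      simp only [Finset.mem_sdiff, Finset.mem_insert, Finset.mem_erase]
      constructor
      · rintro ⟨rfl | h1, h2⟩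
        · exact absurd hy.1 h2
        · exact ⟨h1.1, h1.2, h2⟩
      · rintro ⟨h1, h2, h3⟩
        exact ⟨Or.inr ⟨h1, h2⟩, h3⟩
    rw [this, Finset.card_erase_of_mem (Finset.mem_sdiff.2 hx)]; omega

theorem johnson' {V : Type*} [DecidableEq V] {H : Finset (Finset V)}
    {cH : Finset V → Bool} (hH4 : ∀ e ∈ H, e.card = 4) {Q : Finset V} {c : Bool}
    (h : ∀ f ⊆ Q, f.card = 4 → f ∈ H ∧ cH f = c) {f g : Finset V} (hf : f ⊆ Q) (hg : g ⊆ Q)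
    (hf4 : f.card = 4) (hg4 : g.card = 4) : K H cH f = K H cH g :=
  johnson hH4 h _ f g hf hg hf4 hg4 rfl

/-- uncovered vertices -/
def left {V : Type*} [Fintype V] [DecidableEq V] (M : Finset (Finset V)) : Finset V :=
  Finset.univ \ M.biUnion id

theorem disj_of_left {V : Type*} [Fintype V] [DecidableEq V] {M : Finset (Finset V)}
    {g f : Finset V} (hg : g ⊆ left M) (hf : f ∈ M) : Disjoint g f := by
  rw [Finset.disjoint_left]
  intro x hx hxf
  have := hg hx
  simp only [left, Finset.mem_sdiff, Finset.mem_univ, true_and, Finset.mem_biUnion, id,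
    not_exists, not_and] at this
  exact this f hf hxf

theorem matching_insert {V : Type*} [DecidableEq V] {M : Finset (Finset V)}
    (hM : IsMatching M) {g : Finset V} (hg : ∀ f ∈ M, Disjoint g f) :
    IsMatching (insert g M) := by
  intro e he f hf hef
  rw [Finset.mem_insert] at he hf
  rcases he with rfl | he <;> rcases hf with rfl | hf
  · exact absurd rfl hef
  · exact hg f hf
  · exact (hg e he).symm
  · exact hM e he f hf hef

theorem notMem_of_left {V : Type*} [Fintype V] [DecidableEq V] {M : Finset (Finset V)}
    {g : Finset V} (hg : g ⊆ left M) (h4 : g.card = 4) : g ∉ M := by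
  intro h
  have := disj_of_left hg h
  rw [disjoint_self, Finset.bot_eq_empty] at this
  rw [this] at h4
  simp at h4

theorem finish {V : Type*} [Fintype V] [DecidableEq V] {H : Finset (Finset V)}
    {cH : Finset V → Bool} (hH4 : ∀ e ∈ H, e.card = 4)
    (kk : Bool → (TG H cH).ConnectedComponent) (T : ℕ) (M : Finset (Finset V))
    (hM : IsMatching M) (hMH : ∀ f ∈ M, f ∈ H ∧ K H cH f = kk (cH f))
    (hex : ∀ W ⊆ left M, T ≤ W.card → ∃ g ⊆ W, g ∈ H ∧ K H cH g = kk (cH g)) :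
    ∃ F ⊆ H, IsMatching F ∧ (∀ f ∈ F, ∀ g ∈ F, cH f = cH g → K H cH f = K H cH g) ∧
      (left F).card < T := by
  obtain ⟨F, hF, hmax⟩ := Set.exists_max_image
    {F : Finset (Finset V) | IsMatching F ∧ M ⊆ F ∧ ∀ f ∈ F, f ∈ H ∧ K H cH f = kk (cH f)}
    (fun F => F.card) (Set.toFinite _) ⟨M, hM, Finset.Subset.refl _, hMH⟩
  obtain ⟨h1, h2, h3⟩ := hF
  refine ⟨F, fun f hf => (h3 f hf).1, h1, ?_, ?_⟩
  · intro f hf g hg hc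
    rw [(h3 f hf).2, (h3 g hg).2, hc]
  · by_contra hT
    push Not at hT
    have hsub : left F ⊆ left M :=
      Finset.sdiff_subset_sdiff (Finset.Subset.refl _) (Finset.biUnion_subset_biUnion_of_subset_left _ h2)
    obtain ⟨g, hg, hgH, hgK⟩ := hex _ hsub hT
    have hgF := notMem_of_left hg (hH4 g hgH)
    have := hmax (insert g F) ⟨matching_insert h1 fun f hf => disj_of_left hg hf,
      h2.trans (Finset.subset_insert _ _), by
        intro f hf
        rw [Finset.mem_insert] at hf
        rcases hf with rfl | hf
        · exact ⟨hgH, hgK⟩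
        · exact h3 f hf⟩
    simp only [Finset.card_insert_of_notMem hgF] at this
    omega

/-- The hypotheses on clean sets. -/
structure Sys {V : Type*} [Fintype V] [DecidableEq V] (H : Finset (Finset V))
    (cH : Finset V → Bool) (T : ℕ) where
  hH4 : ∀ e ∈ H, e.card = 4
  Clean : Finset V → Prop
  col : Finset V → Bool
  comp : Finset V → (TG H cH).ConnectedComponent
  c0 : Bool
  k0 : (TG H cH).ConnectedComponent
  hempty : Clean ∅
  hmono : ∀ A B, A ⊆ B → Clean B → Clean A
  hExt : ∀ A B W : Finset V, Clean A → Clean B → A.card ≤ 6 → B.card ≤ 6 → T ≤ W.card →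
    ∃ U ⊆ W, U.card = 4 ∧ Disjoint U A ∧ Disjoint U B ∧ Clean (A ∪ U) ∧ Clean (B ∪ U)
  hH : ∀ f, Clean f → f.card = 4 → f ∈ H
  hK : ∀ f e, Clean f → e ⊆ f → e.card = 2 → f.card = 4 → cH f = col e → K H cH f = comp e
  hinc : ∀ x y z, Clean {x, y, z} → x ≠ y → x ≠ z → y ≠ z → col {x, y} = col {x, z} →
    comp {x, y} = comp {x, z}
  hc0 : ∀ e, Clean e → e.card = 2 → col e = c0 → comp e = k0

namespace Sys
variable {V : Type*} [Fintype V] [DecidableEq V] {H : Finset (Finset V)}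
    {cH : Finset V → Bool} {T : ℕ} (S : Sys H cH T)

def Rp (f : Finset V) : Prop := f ∈ H ∧ cH f = S.c0 ∧ K H cH f = S.k0 ∧
  ∃ e ⊆ f, e.card = 2 ∧ S.Clean e ∧ S.col e = S.c0

def Bp (k : (TG H cH).ConnectedComponent) (f : Finset V) : Prop :=
  f ∈ H ∧ cH f = !S.c0 ∧ K H cH f = k ∧
  ∃ e ⊆ f, e.card = 2 ∧ S.Clean e ∧ S.col e = (!S.c0) ∧ S.comp e = k

def Adm (k : (TG H cH).ConnectedComponent) (M : Finset (Finset V)) : Prop :=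
  IsMatching M ∧ ∀ f ∈ M, S.Rp f ∨ S.Bp k f

def Mx (k : (TG H cH).ConnectedComponent) (M : Finset (Finset V)) : Prop :=
  S.Adm k M ∧ ∀ k' M', S.Adm k' M' → M'.card ≤ M.card

variable {S}

theorem mkRp {f e : Finset V} (hf : S.Clean f) (hf4 : f.card = 4) (he : e ⊆ f) (he2 : e.card = 2)
    (hc : S.col e = S.c0) (hfc : cH f = S.c0) : S.Rp f := by
  have hce := S.hmono _ _ he hf
  refine ⟨S.hH f hf hf4, hfc, ?_, e, he, he2, hce, hc⟩
  rw [S.hK f e hf he he2 hf4 (by rw [hfc, hc]), S.hc0 e hce he2 hc]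

theorem mkBp {f e : Finset V} (hf : S.Clean f) (hf4 : f.card = 4) (he : e ⊆ f) (he2 : e.card = 2)
    (hc : S.col e = !S.c0) (hfc : cH f = !S.c0) : S.Bp (S.comp e) f := by
  have hce := S.hmono _ _ he hf
  exact ⟨S.hH f hf hf4, hfc, S.hK f e hf he he2 hf4 (by rw [hfc, hc]), e, he, he2, hce, hc, rfl⟩

theorem rb_mem {k} {g : Finset V} (hg : S.Rp g ∨ S.Bp k g) : g ∈ H := by
  rcases hg with h | h <;> exact h.1

theorem noedge {k M} (h : S.Mx k M) {g : Finset V} (hg : g ⊆ left M) :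
    ¬ (S.Rp g ∨ S.Bp k g) := by
  intro hgg
  have hn := notMem_of_left hg (S.hH4 g (rb_mem hgg))
  have := h.2 k (insert g M) ⟨matching_insert h.1.1 fun f hf => disj_of_left hg hf, by
    intro f hf
    rw [Finset.mem_insert] at hf
    rcases hf with rfl | hf
    · exact hgg
    · exact h.1.2 f hf⟩
  rw [Finset.card_insert_of_notMem hn] at this
  omega

theorem swap {k M} (h : S.Mx k M) {f g : Finset V} (hf : f ∈ M) (hg : g ⊆ f ∪ left M)
    (hgg : S.Rp g ∨ S.Bp k g) :
    g ∉ M.erase f ∧ S.Mx k (insert g (M.erase f)) := by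
  have hd : ∀ f' ∈ M.erase f, Disjoint g f' := by
    intro f' hf'
    rw [Finset.mem_erase] at hf'
    refine Finset.disjoint_of_subset_left hg ?_
    rw [Finset.disjoint_union_left]
    exact ⟨h.1.1 f hf f' hf'.2 hf'.1.symm, disj_of_left (Finset.Subset.refl _) hf'.2⟩
  have hn : g ∉ M.erase f := by
    intro hgm
    have h1 := hd g hgm
    rw [disjoint_self, Finset.bot_eq_empty] at h1
    have h2 := S.hH4 g (rb_mem hgg)
    rw [h1] at h2
    simp at h2
  refine ⟨hn, ⟨matching_insert (fun a ha b hb => h.1.1 a (Finset.mem_of_mem_erase ha) b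
    (Finset.mem_of_mem_erase hb)) hd, ?_⟩, ?_⟩
  · intro f' hf'
    rw [Finset.mem_insert] at hf'
    rcases hf' with rfl | hf'
    · exact hgg
    · exact h.1.2 f' (Finset.mem_of_mem_erase hf')
  · intro k' M' hM'
    rw [Finset.card_insert_of_notMem hn, Finset.card_erase_of_mem hf]
    have := h.2 k' M' hM'
    have := Finset.card_pos.2 ⟨f, hf⟩
    omega

theorem left_swap {M : Finset (Finset V)} {f g : Finset V} :
    left M \ g ⊆ left (insert g (M.erase f)) := by
  intro x hx
  simp only [left, Finset.mem_sdiff, Finset.mem_univ, true_and, Finset.mem_biUnion, id,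
    not_exists, not_and, Finset.mem_insert, Finset.mem_erase] at hx ⊢
  rintro f' (rfl | hf')
  · exact hx.2
  · exact hx.1 f' hf'.2

/-- structure of clean sets with a class-`k` pair and no useful edges -/
theorem caseI {k} {Q e0 : Finset V} (hQ : S.Clean Q) (h4 : 4 ≤ Q.card) (he0 : e0 ⊆ Q)
    (he2 : e0.card = 2) (hc : S.col e0 = !S.c0) (hk : S.comp e0 = k)
    (hno : ∀ g ⊆ Q, ¬ (S.Rp g ∨ S.Bp k g)) :
    (∀ e ⊆ Q, e.card = 2 → S.col e = (!S.c0) ∧ S.comp e = k) ∧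
    (∀ g ⊆ Q, g.card = 4 → g ∈ H ∧ cH g = S.c0) := by
  have hred : ∀ g ⊆ Q, g.card = 4 → ∀ e ⊆ g, e.card = 2 → S.col e = (!S.c0) → S.comp e = k →
      cH g = S.c0 := by
    intro g hg hg4 e he he2 hc hk
    by_contra hne
    have hne' : cH g = !S.c0 := by
      cases h1 : cH g <;> cases h2 : S.c0 <;> simp_all
    exact hno g hg (Or.inr (hk ▸ mkBp (S.hmono _ _ hg hQ) hg4 he he2 hc hne'))
  have hcol : ∀ e ⊆ Q, e.card = 2 → S.col e = !S.c0 := by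
    intro e he hee
    have h1 : (e0 ∪ e).card ≤ 4 := (Finset.card_union_le _ _).trans (by omega)
    obtain ⟨g, hg1, hg2, hg4⟩ := Finset.exists_subsuperset_card_eq
      (Finset.union_subset he0 he) h1 h4
    have h2 := hred g hg2 hg4 e0 (Finset.subset_union_left.trans hg1) he2 hc hk
    by_contra hne
    have hne' : S.col e = S.c0 := by
      cases h1 : S.col e <;> cases h2 : S.c0 <;> simp_all
    exact hno g hg2 (Or.inl (mkRp (S.hmono _ _ hg2 hQ) hg4 (Finset.subset_union_right.trans hg1)
      hee hne' h2))
  have hcomp : ∀ e ⊆ Q, e.card = 2 → S.comp e = k := by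
    obtain ⟨x, y, hxy, rfl⟩ := Finset.card_eq_two.1 he2
    have hx : x ∈ Q := he0 (by simp)
    have hy : y ∈ Q := he0 (by simp)
    have key : ∀ a ∈ Q, ∀ b ∈ Q, ∀ c ∈ Q, a ≠ b → a ≠ c → S.comp {a, b} = S.comp {a, c} := by
      intro a ha b hb c hcc hab hac
      by_cases hbc : b = c
      · rw [hbc]
      · refine S.hinc a b c (S.hmono _ _ ?_ hQ) hab hac hbc ?_
        · intro z hz
          simp only [Finset.mem_insert, Finset.mem_singleton] at hz
          rcases hz with rfl | rfl | rfl <;> assumption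
        · rw [hcol {a, b} (by simp [Finset.insert_subset_iff, *]) (Finset.card_pair hab),
            hcol {a, c} (by simp [Finset.insert_subset_iff, *]) (Finset.card_pair hac)]
    intro e he hee
    obtain ⟨a, b, hab, rfl⟩ := Finset.card_eq_two.1 hee
    have ha : a ∈ Q := he (by simp)
    have hb : b ∈ Q := he (by simp)
    by_cases hax : a = x
    · subst hax
      rw [← hk]; exact key a ha b hb y hy hab hxy
    · rw [key a ha b hb x hx hab hax, Finset.pair_comm, key x hx a ha y hy (Ne.symm hax) hxy, hk]
  refine ⟨fun e he hee => ⟨hcol e he hee, hcomp e he hee⟩, fun g hg hg4 =>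
    ⟨S.hH g (S.hmono _ _ hg hQ) hg4, ?_⟩⟩
  obtain ⟨e, he, hee⟩ := Finset.exists_subset_card_eq (s := g) (n := 2) (by omega)
  exact hred g hg hg4 e he hee (hcol e (he.trans hg) hee) (hcomp e (he.trans hg) hee)

theorem two_in {A U g : Finset V} (hA : A.card = 2) (hg : g ⊆ A ∪ U) (hg4 : g.card = 4) :
    ∃ e ⊆ g, e ⊆ U ∧ e.card = 2 := by
  have h1 : g = g ∩ A ∪ g ∩ U := by
    rw [← Finset.inter_union_distrib_left, Finset.inter_eq_left.2 hg]
  have h2 : g.card ≤ (g ∩ A).card + (g ∩ U).card := by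
    conv_lhs => rw [h1]
    exact Finset.card_union_le _ _
  have h3 : (g ∩ A).card ≤ 2 := hA ▸ Finset.card_le_card Finset.inter_subset_right
  obtain ⟨e, he, hee⟩ := Finset.exists_subset_card_eq (s := g ∩ U) (n := 2) (by omega)
  exact ⟨e, he.trans Finset.inter_subset_left, he.trans Finset.inter_subset_right, hee⟩

theorem bne {a b : Bool} (h : ¬ a = b) : a = !b := by cases a <;> cases b <;> simp_all

theorem bcol {f : Finset V} {k} (h : S.Rp f ∨ S.Bp k f) (hc : cH f = !S.c0) : S.Bp k f := by
  rcases h with h | h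
  · have := h.2.1
    rw [hc] at this
    simp at this
  · exact h

theorem core_I {k M} (hM : S.Mx k M) (hT : ∀ M', M'.card = M.card → S.Adm k M' → T ≤ (left M').card)
    {e0 : Finset V} (he0 : e0 ⊆ left M)
    (he2 : e0.card = 2) (hce : S.Clean e0) (hc : S.col e0 = !S.c0) (hk : S.comp e0 = k) :
    ∃ F ⊆ H, IsMatching F ∧ (∀ f ∈ F, ∀ g ∈ F, cH f = cH g → K H cH f = K H cH g) ∧
      (left F).card < T := by
  classical
  obtain ⟨M₁, hM1, hmin⟩ := Set.exists_min_image
    {M' : Finset (Finset V) | S.Mx k M' ∧ ∃ e0 ⊆ left M', e0.card = 2 ∧ S.Clean e0 ∧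
      S.col e0 = (!S.c0) ∧ S.comp e0 = k}
    (fun F => (F.filter (fun f => cH f = S.c0)).card) (Set.toFinite _)
    ⟨M, hM, e0, he0, he2, hce, hc, hk⟩
  have hcard : M₁.card = M.card := le_antisymm (hM.2 _ _ hM1.1.1) (hM1.1.2 _ _ hM.1)
  have hT1 := hT M₁ hcard hM1.1.1
  clear hT he0 he2 hce hc hk hM hcard
  clear e0 M
  obtain ⟨hM, e0, he0, he2, hce, hc, hk⟩ := hM1
  obtain ⟨U0, hU0, hU04, hd0, -, hcl0, -⟩ := S.hExt e0 ∅ _ hce S.hempty (by omega) (by simp) hT1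
  have hQ6 : (e0 ∪ U0).card = 6 := by
    rw [Finset.card_union_of_disjoint hd0.symm]; omega
  -- main claim on extensions
  have claim : ∀ U ⊆ left M₁, U.card = 4 → S.Clean (e0 ∪ U0 ∪ U) →
      (∀ e ⊆ U, e.card = 2 → S.col e = (!S.c0) ∧ S.comp e = k) ∧ U ∈ H ∧ cH U = S.c0 ∧
      K H cH U = K H cH U0 := by
    intro U hU hU4 hcl
    have hsub : e0 ∪ U0 ∪ U ⊆ left M₁ := Finset.union_subset (Finset.union_subset he0 hU0) hU
    have hle := Finset.card_le_card (Finset.subset_union_left (s₁ := e0 ∪ U0) (s₂ := U))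
    obtain ⟨h1, h2⟩ := caseI (e0 := e0) (k := k) hcl (by omega)
      (Finset.subset_union_left.trans Finset.subset_union_left) he2 hc hk
      (fun g hg => noedge hM (hg.trans hsub))
    refine ⟨fun e he hee => h1 e (he.trans Finset.subset_union_right) hee,
      (h2 U Finset.subset_union_right hU4).1, (h2 U Finset.subset_union_right hU4).2, ?_⟩
    exact johnson' S.hH4 h2 Finset.subset_union_right
      (Finset.subset_union_right.trans Finset.subset_union_left) hU4 hU04
  have hfin : (K H cH U0 = S.k0 ∨ ∀ f ∈ M₁, S.Bp k f) := by
    by_contra hcon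
    push Not at hcon
    obtain ⟨hne, f, hf, hfB⟩ := hcon
    have hfR : S.Rp f := (hM.1.2 f hf).resolve_right hfB
    obtain ⟨ab, hab, hab2, habc, habcol⟩ := hfR.2.2.2
    obtain ⟨U, hU, hU4, hdQ, hdab, hclQ, hclab⟩ := S.hExt (e0 ∪ U0) ab _ hcl0 habc (by omega)
      (by omega) hT1
    obtain ⟨hpairs, hUH, hUc, hUK⟩ := claim U hU hU4 hclQ
    have hnoB : ∀ g ⊆ ab ∪ U, ¬ S.Bp k g := by
      intro g hg hgB
      have hgsub : g ⊆ f ∪ left M₁ := hg.trans (Finset.union_subset_union hab hU)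
      obtain ⟨hgn, hsw⟩ := swap hM hf hgsub (Or.inr hgB)
      have hdisj : Disjoint e0 g := by
        refine Finset.disjoint_of_subset_right hg ?_
        rw [Finset.disjoint_union_right]
        refine ⟨?_, ?_⟩
        · exact Finset.disjoint_of_subset_right hab (disj_of_left he0 hf)
        · exact Finset.disjoint_of_subset_left Finset.subset_union_left hdQ.symm
      have := hmin (insert g (M₁.erase f)) ⟨hsw, e0, ?_, he2, hce, hc, hk⟩
      · rw [Finset.filter_insert, if_neg (by rw [hgB.2.1]; simp), Finset.filter_erase,
          Finset.card_erase_of_mem (Finset.mem_filter.2 ⟨hf, hfR.2.1⟩)] at this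
        have hp : 0 < (M₁.filter (fun f => cH f = S.c0)).card :=
          Finset.card_pos.2 ⟨f, Finset.mem_filter.2 ⟨hf, hfR.2.1⟩⟩
        omega
      · refine Finset.Subset.trans ?_ left_swap
        intro x hx
        exact Finset.mem_sdiff.2 ⟨he0 hx, Finset.disjoint_left.1 hdisj hx⟩
    have hall : ∀ g ⊆ ab ∪ U, g.card = 4 → g ∈ H ∧ cH g = S.c0 := by
      intro g hg hg4
      have hgc := S.hmono _ _ hg hclab
      refine ⟨S.hH g hgc hg4, ?_⟩
      by_contra hne
      obtain ⟨e, heg, heU, he2⟩ := two_in hab2 hg hg4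
      obtain ⟨h1, h2⟩ := hpairs e heU he2
      exact hnoB g hg (h2 ▸ mkBp hgc hg4 heg he2 h1 (bne hne))
    obtain ⟨u, hu, hu2⟩ := Finset.exists_subset_card_eq (s := U) (n := 2) (by omega)
    have hsub : ab ∪ u ⊆ ab ∪ U := Finset.union_subset_union (Finset.Subset.refl _) hu
    have hc4 : (ab ∪ u).card = 4 := by
      rw [Finset.card_union_of_disjoint (Finset.disjoint_of_subset_right hu hdab.symm)]; omega
    have e1 := johnson' S.hH4 hall hsub Finset.subset_union_right hc4 hU4
    have e2 := (mkRp (S.hmono _ _ hsub hclab) hc4 Finset.subset_union_left hab2 habcol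
      (hall _ hsub hc4).2).2.2.1
    exact hne (by rw [← hUK, ← e1, e2])
  refine finish S.hH4 (fun c => if c = S.c0 then K H cH U0 else k) T M₁ hM.1.1 ?_ ?_
  · intro f hf
    refine ⟨rb_mem (hM.1.2 f hf), ?_⟩
    have hB : S.Bp k f → K H cH f = if cH f = S.c0 then K H cH U0 else k := by
      intro h
      rw [h.2.1, if_neg (by simp), h.2.2.1]
    rcases hfin with h | h
    · rcases hM.1.2 f hf with h' | h'
      · rw [h'.2.1, if_pos rfl, h'.2.2.1, h]
      · exact hB h'
    · exact hB (h f hf)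
  · intro W hW hWT
    obtain ⟨U, hU, hU4, -, -, hclQ, -⟩ := S.hExt (e0 ∪ U0) ∅ W hcl0 S.hempty (by omega) (by simp)
      hWT
    obtain ⟨-, hUH, hUc, hUK⟩ := claim U (hU.trans hW) hU4 hclQ
    exact ⟨U, hU, hUH, by rw [hUc, if_pos rfl, hUK]⟩

theorem core (S : Sys H cH T) :
    ∃ F ⊆ H, IsMatching F ∧ (∀ f ∈ F, ∀ g ∈ F, cH f = cH g → K H cH f = K H cH g) ∧
      (left F).card < T := by
  classical
  by_contra hcon
  have hT : ∀ k M, S.Adm k M → T ≤ (left M).card := by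
    intro k M hM
    by_contra hlt
    push Not at hlt
    refine hcon ⟨M, fun f hf => rb_mem (hM.2 f hf), hM.1, ?_, hlt⟩
    intro f hf g hg hc
    rcases hM.2 f hf with h1 | h1 <;> rcases hM.2 g hg with h2 | h2
    · rw [h1.2.2.1, h2.2.2.1]
    · rw [h1.2.1, h2.2.1] at hc; simp at hc
    · rw [h1.2.1, h2.2.1] at hc; simp at hc
    · rw [h1.2.2.1, h2.2.2.1]
  have hnoI : ∀ k M, S.Mx k M → ∀ e0 ⊆ left M, e0.card = 2 → S.Clean e0 → S.col e0 = (!S.c0) →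
      S.comp e0 ≠ k := by
    intro k M hM e0 he0 he2 hce hc hk
    exact hcon (core_I hM (fun M' _ h => hT k M' h) he0 he2 hce hc hk)
  obtain ⟨⟨k1, M1⟩, hadm1, hmax1⟩ := Set.exists_max_image
    {p : (TG H cH).ConnectedComponent × Finset (Finset V) | S.Adm p.1 p.2}
    (fun p => p.2.card) (Set.toFinite _) ⟨(S.k0, ∅), by simp [Adm, IsMatching]⟩
  have hMx1 : S.Mx k1 M1 := ⟨hadm1, fun k' M' h => hmax1 (k', M') h⟩
  obtain ⟨⟨k, M⟩, hM, hmin⟩ := Set.exists_min_image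
    {p : (TG H cH).ConnectedComponent × Finset (Finset V) | S.Mx p.1 p.2}
    (fun p => (p.2.filter (fun f => cH f = !S.c0)).card) (Set.toFinite _) ⟨(k1, M1), hMx1⟩
  simp only [Set.mem_ofPred_eq] at hM
  by_cases hB : ∃ f ∈ M, S.Bp k f
  · obtain ⟨f, hf, hfB⟩ := hB
    obtain ⟨ab, hab, hab2, habc, habcol, habk⟩ := hfB.2.2.2
    have hnoR : ∀ g ⊆ f ∪ left M, ¬ S.Rp g := by
      intro g hg hgR
      obtain ⟨hgn, hsw⟩ := swap hM hf hg (Or.inl hgR)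
      have := hmin (k, insert g (M.erase f)) hsw
      simp only at this
      rw [Finset.filter_insert, if_neg (by rw [hgR.2.1]; simp), Finset.filter_erase,
        Finset.card_erase_of_mem (Finset.mem_filter.2 ⟨hf, hfB.2.1⟩)] at this
      have hp : 0 < (M.filter (fun f => cH f = !S.c0)).card :=
        Finset.card_pos.2 ⟨f, Finset.mem_filter.2 ⟨hf, hfB.2.1⟩⟩
      omega
    have claim : ∀ U ⊆ left M, U.card = 4 → Disjoint U ab → S.Clean (ab ∪ U) →
        U ∈ H ∧ cH U = (!S.c0) ∧ K H cH U = k := by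
      intro U hU hU4 hd hcl
      have hsubf : ab ∪ U ⊆ f ∪ left M := Finset.union_subset_union hab hU
      have hred : ∀ e ⊆ U, e.card = 2 → S.col e = S.c0 := by
        intro e he hee
        by_contra hne
        have hne := bne hne
        have hk' := hnoI k M hM e (he.trans hU) hee
          (S.hmono _ _ (he.trans Finset.subset_union_right) hcl) hne
        have hsub : ab ∪ e ⊆ ab ∪ U := Finset.union_subset_union (Finset.Subset.refl _) he
        have hcg := S.hmono _ _ hsub hcl
        have hd' : Disjoint ab e := Finset.disjoint_of_subset_right he hd.symm
        have hg4 : (ab ∪ e).card = 4 := by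
          rw [Finset.card_union_of_disjoint hd']; omega
        have hgc : cH (ab ∪ e) = S.c0 := by
          by_contra h
          have h := bne h
          have e1 := S.hK _ ab hcg Finset.subset_union_left hab2 hg4 (by rw [h, habcol])
          have e2 := S.hK _ e hcg Finset.subset_union_right hee hg4 (by rw [h, hne])
          exact hk' (by rw [← e2, e1, habk])
        obtain ⟨a, b, hab', rfl⟩ := Finset.card_eq_two.1 hab2
        obtain ⟨u, v, huv, rfl⟩ := Finset.card_eq_two.1 hee
        have hau : a ≠ u := fun h => Finset.disjoint_left.1 hd' (show a ∈ _ by simp) (by simp [h])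
        have hav : a ≠ v := fun h => Finset.disjoint_left.1 hd' (show a ∈ _ by simp) (by simp [h])
        have hbu : b ≠ u := fun h => Finset.disjoint_left.1 hd' (show b ∈ _ by simp) (by simp [h])
        have haucol : S.col {a, u} = S.c0 := by
          by_contra h
          have h := bne h
          have e1 := S.hinc a b u (S.hmono _ _ (by
            intro z hz; simp only [Finset.mem_insert, Finset.mem_singleton, Finset.mem_union] at hz ⊢
            tauto) hcg) hab' hau hbu (by rw [habcol, h])
          have e2 := S.hinc u a v (S.hmono _ _ (by
            intro z hz; simp only [Finset.mem_insert, Finset.mem_singleton, Finset.mem_union] at hz ⊢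
            tauto) hcg) hau.symm huv hav (by rw [hne, Finset.pair_comm, h])
          exact hk' (by rw [← e2, Finset.pair_comm, ← e1, habk])
        exact hnoR _ (hsub.trans hsubf) (mkRp (e := {a, u}) hcg hg4 (by
            intro z hz; simp only [Finset.mem_insert, Finset.mem_singleton, Finset.mem_union] at hz ⊢
            tauto) (Finset.card_pair hau) haucol hgc)
      have hall : ∀ g ⊆ ab ∪ U, g.card = 4 → g ∈ H ∧ cH g = !S.c0 := by
        intro g hg hg4
        have hgc := S.hmono _ _ hg hcl
        refine ⟨S.hH g hgc hg4, bne ?_⟩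
        intro hne
        obtain ⟨e, heg, heU, he2⟩ := two_in hab2 hg hg4
        exact hnoR g (hg.trans hsubf) (mkRp hgc hg4 heg he2 (hred e heU he2) hne)
      obtain ⟨u, hu, hu2⟩ := Finset.exists_subset_card_eq (s := U) (n := 2) (by omega)
      have hsub : ab ∪ u ⊆ ab ∪ U := Finset.union_subset_union (Finset.Subset.refl _) hu
      have hc4 : (ab ∪ u).card = 4 := by
        rw [Finset.card_union_of_disjoint (Finset.disjoint_of_subset_right hu hd.symm)]; omega
      have e1 := johnson' S.hH4 hall hsub Finset.subset_union_right hc4 hU4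
      have e2 := (mkBp (S.hmono _ _ hsub hcl) hc4 Finset.subset_union_left hab2 habcol
        (hall _ hsub hc4).2).2.2.1
      obtain ⟨h1, h2⟩ := hall U Finset.subset_union_right hU4
      exact ⟨h1, h2, by rw [← e1, e2, habk]⟩
    refine hcon (finish S.hH4 (fun c => if c = S.c0 then S.k0 else k) T M hM.1.1 ?_ ?_)
    · intro f hf
      refine ⟨rb_mem (hM.1.2 f hf), ?_⟩
      rcases hM.1.2 f hf with h' | h'
      · rw [h'.2.1, if_pos rfl, h'.2.2.1]
      · rw [h'.2.1, if_neg (by simp), h'.2.2.1]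
    · intro W hW hWT
      obtain ⟨U, hU, hU4, hd, -, hclQ, -⟩ := S.hExt ab ∅ W habc S.hempty (by omega) (by simp) hWT
      obtain ⟨hUH, hUc, hUK⟩ := claim U (hU.trans hW) hU4 hd hclQ
      exact ⟨U, hU, hUH, by rw [hUc, if_neg (by simp), hUK]⟩
  · push Not at hB
    have hR : ∀ f ∈ M, S.Rp f := fun f hf => (hM.1.2 f hf).resolve_right (hB f hf)
    have hMk : ∀ k', S.Mx k' M := fun k' => ⟨⟨hM.1.1, fun f hf => Or.inl (hR f hf)⟩, hM.2⟩
    have hred : ∀ e ⊆ left M, e.card = 2 → S.Clean e → S.col e = S.c0 := by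
      intro e he hee hce
      by_contra hne
      exact hnoI _ M (hMk (S.comp e)) e he hee hce (bne hne) rfl
    have hT1 := hT k M hM.1
    obtain ⟨U0, hU0, hU04, -, -, hcl0, -⟩ := S.hExt ∅ ∅ _ S.hempty S.hempty (by simp) (by simp) hT1
    rw [Finset.empty_union] at hcl0
    refine hcon (finish S.hH4 (fun c => if c = S.c0 then S.k0 else K H cH U0) T M hM.1.1 ?_ ?_)
    · intro f hf
      refine ⟨(hR f hf).1, ?_⟩
      rw [(hR f hf).2.1, if_pos rfl, (hR f hf).2.2.1]
    · intro W hW hWT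
      obtain ⟨U, hU, hU4, hd, -, hclQ, -⟩ := S.hExt U0 ∅ W hcl0 S.hempty (by omega) (by simp) hWT
      have hall : ∀ g ⊆ U0 ∪ U, g.card = 4 → g ∈ H ∧ cH g = !S.c0 := by
        intro g hg hg4
        have hgc := S.hmono _ _ hg hclQ
        refine ⟨S.hH g hgc hg4, bne ?_⟩
        intro hne
        have hgl : g ⊆ left M := hg.trans (Finset.union_subset hU0 (hU.trans hW))
        obtain ⟨e, heg, he2⟩ := Finset.exists_subset_card_eq (s := g) (n := 2) (by omega)
        exact noedge hM hgl (Or.inl (mkRp hgc hg4 heg he2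
          (hred e (heg.trans hgl) he2 (S.hmono _ _ heg hgc)) hne))
      obtain ⟨h1, h2⟩ := hall U Finset.subset_union_right hU4
      exact ⟨U, hU, h1, by
        rw [h2, if_neg (by simp)]
        exact johnson' S.hH4 hall Finset.subset_union_right Finset.subset_union_left hU4 hU04⟩

end Sys

section counting
open Classical

/-- number of elements satisfying a predicate, as a real -/
noncomputable def cnt {α : Type*} [Fintype α] (p : α → Prop) : ℝ :=
  ((Finset.univ.filter p).card : ℝ)

theorem cnt_prod {α β : Type*} [Fintype α] [Fintype β] (r : α → β → Prop) :
    cnt (fun p : α × β => r p.1 p.2) = ∑ a, cnt (fun b => r a b) := by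
  unfold cnt
  simp only [Finset.card_filter]
  rw [Fintype.sum_prod_type]
  push_cast
  rfl

theorem fib {α β : Type*} [Fintype α] [Fintype β] (r : α → β → Prop) (D : α → Prop) (m : ℝ)
    (h : ∀ a, D a → m ≤ cnt (fun b => r a b)) :
    cnt D * m ≤ cnt (fun p : α × β => r p.1 p.2) := by
  rw [cnt_prod]
  calc cnt D * m = ∑ a ∈ Finset.univ.filter D, m := by simp [cnt]
    _ ≤ ∑ a ∈ Finset.univ.filter D, cnt (fun b => r a b) :=
        Finset.sum_le_sum (fun a ha => h a (Finset.mem_filter.1 ha).2)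
    _ ≤ _ := Finset.sum_le_sum_of_subset_of_nonneg (Finset.subset_univ _)
        (fun _ _ _ => Nat.cast_nonneg _)

theorem fib_le {α β : Type*} [Fintype α] [Fintype β] (r : α → β → Prop) (m : ℝ)
    (h : ∀ a, cnt (fun b => r a b) ≤ m) :
    cnt (fun p : α × β => r p.1 p.2) ≤ Fintype.card α * m := by
  rw [cnt_prod]
  calc _ ≤ ∑ a : α, m := Finset.sum_le_sum (fun a _ => h a)
    _ = _ := by simp

theorem cnt_mono {α : Type*} [Fintype α] {p q : α → Prop} (h : ∀ a, p a → q a) :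
    cnt p ≤ cnt q := by
  unfold cnt
  exact_mod_cast Finset.card_le_card (fun a ha => by
    rw [Finset.mem_filter] at ha ⊢; exact ⟨ha.1, h a ha.2⟩)

theorem cnt_eq {α : Type*} [Fintype α] (p : α → Prop) [DecidablePred p] :
    cnt p = ((Finset.univ.filter p).card : ℝ) := by
  unfold cnt
  congr!

theorem cnt_or {α : Type*} [Fintype α] (p q : α → Prop) :
    cnt (fun a => p a ∨ q a) ≤ cnt p + cnt q := by
  have h : (Finset.univ.filter (fun a => p a ∨ q a)).card ≤
      (Finset.univ.filter p ∪ Finset.univ.filter q).card :=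
    Finset.card_le_card (fun a ha => by simpa using ha)
  rw [cnt_eq (fun a => p a ∨ q a), cnt_eq p, cnt_eq q]
  exact_mod_cast h.trans (Finset.card_union_le _ _)

theorem cnt_exists {α : Type*} [Fintype α] {p : α → Prop} (h : 0 < cnt p) : ∃ a, p a := by
  unfold cnt at h
  obtain ⟨a, ha⟩ := Finset.card_pos.1 (Nat.cast_pos.1 h)
  exact ⟨a, (Finset.mem_filter.1 ha).2⟩

theorem cnt_eq_zero {α : Type*} [Fintype α] {p : α → Prop} (h : ∀ a, ¬ p a) : cnt p = 0 := by
  unfold cnt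
  rw [Finset.filter_eq_empty_iff.2 (fun a _ => h a)]
  simp

theorem cnt_le_card {α : Type*} [Fintype α] (p : α → Prop) : cnt p ≤ Fintype.card α := by
  unfold cnt
  exact_mod_cast Finset.card_le_univ _

theorem cnt_mem {α : Type*} [Fintype α] (s : Finset α) : cnt (fun a => a ∈ s) = s.card := by
  unfold cnt
  congr 2
  ext; simp

theorem cnt_true {α : Type*} [Fintype α] : cnt (fun _ : α => True) = Fintype.card α := by
  rw [cnt_eq]
  simp

theorem cnt_bex {α ι : Type*} [Fintype α] (s : Finset ι) (p : ι → α → Prop) (m : ℝ)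
    (h : ∀ i ∈ s, cnt (p i) ≤ m) : cnt (fun a => ∃ i ∈ s, p i a) ≤ s.card * m := by
  induction s using Finset.induction_on with
  | empty => rw [cnt_eq_zero (by simp)]; simp
  | insert i s hi ih =>
    have h1 := ih (fun j hj => h j (Finset.mem_insert_of_mem hj))
    have h2 := h i (Finset.mem_insert_self _ _)
    have h3 := cnt_or (p i) (fun a => ∃ i ∈ s, p i a)
    have h4 : cnt (fun a => ∃ j ∈ insert i s, p j a) ≤ cnt (fun a => p i a ∨ ∃ j ∈ s, p j a) :=
      cnt_mono (by simp)
    rw [Finset.card_insert_of_notMem hi]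
    push_cast
    linarith

theorem cnt_inj {α β : Type*} [Fintype α] [Fintype β] {p : α → Prop} {q : β → Prop}
    (φ : α → β) (hφ : Function.Injective φ) (h : ∀ a, p a → q (φ a)) : cnt p ≤ cnt q := by
  unfold cnt
  exact_mod_cast Finset.card_le_card_of_injOn φ (fun a ha => by
    simp only [Finset.coe_filter, Finset.mem_univ, true_and] at ha ⊢
    exact h a ha) (hφ.injOn)

theorem cnt_nonneg {α : Type*} [Fintype α] (p : α → Prop) : 0 ≤ cnt p := Nat.cast_nonneg _

/-- six-tuples -/
theorem cnt_six {V : Type*} [Fintype V] (b : V → V → V → Prop)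
    (φ : ((V × V) × (V × V)) × (V × V) → ((V × V) × V) × ((V × V) × V))
    (hφ : Function.Injective φ) :
    cnt (fun t : ((V × V) × (V × V)) × (V × V) => b (φ t).1.1.1 (φ t).1.1.2 (φ t).1.2) ≤
      cnt (fun p : (V × V) × V => b p.1.1 p.1.2 p.2) * (Fintype.card V : ℝ) ^ 3 := by
  refine (cnt_inj (q := fun s : ((V × V) × V) × ((V × V) × V) => b s.1.1.1 s.1.1.2 s.1.2) φ hφ
    (fun a h => h)).trans ?_
  unfold cnt
  have : (Finset.univ.filter (fun s : ((V × V) × V) × ((V × V) × V) => b s.1.1.1 s.1.1.2 s.1.2)) =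
      (Finset.univ.filter (fun p : (V × V) × V => b p.1.1 p.1.2 p.2)) ×ˢ Finset.univ := by
    ext s; simp
  rw [this, Finset.card_product]
  push_cast
  apply le_of_eq
  simp [Fintype.card_prod]
  ring_nf
  simp

theorem dominate {V X : Type*} [Fintype V] [DecidableEq V] [Nonempty X] (col : Finset V → Bool)
    (comp : Finset V → X) (bad : V → V → V → Prop)
    (hg : ∀ a b c, ¬ bad a b c → (col {a, b} = col {a, c} → comp {a, b} = comp {a, c}) ∧
      (col {a, b} = col {b, c} → comp {a, b} = comp {b, c}) ∧
      (col {a, c} = col {b, c} → comp {a, c} = comp {b, c}))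
    (δ : ℝ) (hδ : 0 < δ)
    (hb : cnt (fun p : (V × V) × V => bad p.1.1 p.1.2 p.2) ≤ δ ^ 3 / 7 * (Fintype.card V : ℝ) ^ 3) :
    ∃ c0 k0, cnt (fun p : V × V => col {p.1, p.2} = c0 ∧ comp {p.1, p.2} ≠ k0) ≤
      δ * (Fintype.card V : ℝ) ^ 2 := by
  set n : ℝ := (Fintype.card V : ℝ) with hn
  by_contra hcon
  push Not at hcon
  have hn0 : 0 < n := by
    rcases (Nat.cast_nonneg (Fintype.card V) : (0 : ℝ) ≤ _).lt_or_eq with h | h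
    · exact h
    · exfalso
      have h0 : Fintype.card V = 0 := by exact_mod_cast h.symm
      have : IsEmpty V := Fintype.card_eq_zero_iff.1 h0
      have h1 := hcon true (Classical.arbitrary X)
      have h2 : cnt (fun p : V × V => col {p.1, p.2} = true ∧
        comp {p.1, p.2} ≠ Classical.arbitrary X) = 0 := by
          unfold cnt
          simp
      rw [h2] at h1
      have : 0 ≤ δ * n ^ 2 := by positivity
      linarith
  let Dp : ((V × V) × (V × V)) → Prop := fun t =>
    (col {t.1.1, t.1.2} = true) ∧ (col {t.2.1, t.2.2} = true ∧
      comp {t.2.1, t.2.2} ≠ comp {t.1.1, t.1.2})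
  have hD : δ ^ 2 * n ^ 4 ≤ cnt Dp := by
    have h1 := fib (fun (p q : V × V) => (col {p.1, p.2} = true) ∧ (col {q.1, q.2} = true ∧
      comp {q.1, q.2} ≠ comp {p.1, p.2})) (fun p : V × V => col {p.1, p.2} = true)
      (δ * n ^ 2) (by
        intro p hp
        exact (hcon true (comp {p.1, p.2})).le.trans (cnt_mono fun a h => ⟨hp, h⟩))
    have h2 : δ * n ^ 2 ≤ cnt (fun p : V × V => col {p.1, p.2} = true) :=
      (hcon true (Classical.arbitrary X)).le.trans (cnt_mono (fun a h => h.1))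
    have h3 : δ ^ 2 * n ^ 4 = (δ * n ^ 2) * (δ * n ^ 2) := by ring
    rw [h3]
    refine (mul_le_mul_of_nonneg_right h2 (by positivity)).trans ?_
    exact h1
  -- bad six-tuples
  let bad7 : ((V × V) × (V × V)) → (V × V) → Prop := fun t r =>
    bad t.1.1 t.1.2 t.2.1 ∨ bad t.1.1 t.2.1 t.2.2 ∨ bad r.1 t.1.1 t.2.1 ∨ bad r.1 t.1.1 t.1.2 ∨
    bad r.1 t.2.1 t.2.2 ∨ bad t.1.1 r.1 r.2 ∨ bad t.2.1 r.1 r.2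
  have hall : ∀ t, Dp t → δ * n ^ 2 < cnt (fun r => bad7 t r) := by
    rintro ⟨⟨a, b⟩, c, d⟩ ht
    simp only [Dp] at ht
    obtain ⟨h1, h2, h3⟩ := ht
    refine (hcon false (comp {a, c})).trans_le (cnt_mono ?_)
    rintro ⟨e, f⟩ ⟨hef, hne⟩
    by_contra hbad
    simp only [bad7, not_or] at hbad hef hne
    obtain ⟨b1, b2, b3, b4, b5, b6, b7⟩ := hbad
    obtain ⟨x1, -, -⟩ := hg _ _ _ b1
    obtain ⟨-, x2, -⟩ := hg _ _ _ b2
    obtain ⟨x3, x3', x3''⟩ := hg _ _ _ b3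
    obtain ⟨-, x4, -⟩ := hg _ _ _ b4
    obtain ⟨-, x5, -⟩ := hg _ _ _ b5
    obtain ⟨-, -, -⟩ := hg _ _ _ b6
    obtain ⟨-, x6, -⟩ := hg _ _ _ b6
    obtain ⟨-, x7, -⟩ := hg _ _ _ b7
    rw [Finset.pair_comm a e] at x6
    rw [Finset.pair_comm c e] at x7
    cases hac : col {a, c} <;> cases hea : col {e, a} <;> cases hec : col {e, c} <;>
      simp only [h1, h2, hac, hea, hec, hef, forall_const, reduceCtorEq, false_imp_iff] at * <;>
      simp_all
  have hDpos : 0 < cnt Dp := lt_of_lt_of_le (by positivity) hD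
  have hlow : cnt Dp * (δ * n ^ 2) < cnt (fun s : ((V × V) × (V × V)) × (V × V) => bad7 s.1 s.2) := by
    have hDne : (Finset.univ.filter Dp).Nonempty := by
      obtain ⟨t, ht⟩ := cnt_exists hDpos
      exact ⟨t, Finset.mem_filter.2 ⟨Finset.mem_univ _, ht⟩⟩
    obtain ⟨t0, ht0, hmin⟩ := Finset.exists_min_image (Finset.univ.filter Dp)
      (fun t => cnt (fun r => bad7 t r)) hDne
    have h1 := fib bad7 Dp (cnt (fun r => bad7 t0 r)) (fun a ha => hmin a (by simpa using ha))
    refine lt_of_lt_of_le ?_ h1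
    exact mul_lt_mul_of_pos_left (hall t0 (Finset.mem_filter.1 ht0).2) hDpos
  set β := cnt (fun p : (V × V) × V => bad p.1.1 p.1.2 p.2) * n ^ 3 with hβ
  have hup : cnt (fun s : ((V × V) × (V × V)) × (V × V) => bad7 s.1 s.2) ≤ 7 * β := by
    have y1 := cnt_six bad (fun s => (((s.1.1.1, s.1.1.2), s.1.2.1), ((s.1.2.2, s.2.1), s.2.2)))
      (by rintro ⟨⟨⟨_, _⟩, _, _⟩, _, _⟩ ⟨⟨⟨_, _⟩, _, _⟩, _, _⟩ h; simp at h ⊢; tauto)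
    have y2 := cnt_six bad (fun s => (((s.1.1.1, s.1.2.1), s.1.2.2), ((s.1.1.2, s.2.1), s.2.2)))
      (by rintro ⟨⟨⟨_, _⟩, _, _⟩, _, _⟩ ⟨⟨⟨_, _⟩, _, _⟩, _, _⟩ h; simp at h ⊢; tauto)
    have y3 := cnt_six bad (fun s => (((s.2.1, s.1.1.1), s.1.2.1), ((s.1.1.2, s.1.2.2), s.2.2)))
      (by rintro ⟨⟨⟨_, _⟩, _, _⟩, _, _⟩ ⟨⟨⟨_, _⟩, _, _⟩, _, _⟩ h; simp at h ⊢; tauto)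
    have y4 := cnt_six bad (fun s => (((s.2.1, s.1.1.1), s.1.1.2), ((s.1.2.1, s.1.2.2), s.2.2)))
      (by rintro ⟨⟨⟨_, _⟩, _, _⟩, _, _⟩ ⟨⟨⟨_, _⟩, _, _⟩, _, _⟩ h; simp at h ⊢; tauto)
    have y5 := cnt_six bad (fun s => (((s.2.1, s.1.2.1), s.1.2.2), ((s.1.1.1, s.1.1.2), s.2.2)))
      (by rintro ⟨⟨⟨_, _⟩, _, _⟩, _, _⟩ ⟨⟨⟨_, _⟩, _, _⟩, _, _⟩ h; simp at h ⊢; tauto)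
    have y6 := cnt_six bad (fun s => (((s.1.1.1, s.2.1), s.2.2), ((s.1.1.2, s.1.2.1), s.1.2.2)))
      (by rintro ⟨⟨⟨_, _⟩, _, _⟩, _, _⟩ ⟨⟨⟨_, _⟩, _, _⟩, _, _⟩ h; simp at h ⊢; tauto)
    have y7 := cnt_six bad (fun s => (((s.1.2.1, s.2.1), s.2.2), ((s.1.1.1, s.1.1.2), s.1.2.2)))
      (by rintro ⟨⟨⟨_, _⟩, _, _⟩, _, _⟩ ⟨⟨⟨_, _⟩, _, _⟩, _, _⟩ h; simp at h ⊢; tauto)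
    refine (cnt_or _ _).trans ?_
    refine (add_le_add_right ((cnt_or _ _).trans (add_le_add_right ((cnt_or _ _).trans
      (add_le_add_right ((cnt_or _ _).trans (add_le_add_right ((cnt_or _ _).trans
      (add_le_add_right (cnt_or _ _) _)) _)) _)) _)) _).trans ?_
    simp only [← hn, ← hβ] at y1 y2 y3 y4 y5 y6 y7
    linarith
  have h5 : δ ^ 2 * n ^ 4 * (δ * n ^ 2) ≤ cnt Dp * (δ * n ^ 2) :=
    mul_le_mul_of_nonneg_right hD (by positivity)
  have h6 : β ≤ δ ^ 3 / 7 * n ^ 3 * n ^ 3 := mul_le_mul_of_nonneg_right hb (by positivity)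
  nlinarith

end counting

section dense
open Classical
variable {V : Type*} [Fintype V] [DecidableEq V] {H : Finset (Finset V)} {cH : Finset V → Bool}

/-- active set -/
def Act (H : Finset (Finset V)) (t : Finset V) : Prop := ∃ f ∈ H, t ⊆ f

/-- shadow of a component -/
def Sh (H : Finset (Finset V)) (cH : Finset V → Bool) (t : Finset V) (c : Bool)
    (k : (TG H cH).ConnectedComponent) : Prop := ∃ f ∈ H, t ⊆ f ∧ cH f = c ∧ K H cH f = k

theorem degT3 {t : Finset V} (ht : t.card = 3) :
    (degT 4 H t : ℝ) = cnt (fun u => insert u t ∈ H) := by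
  unfold degT degOn
  rw [ht, cnt_eq]
  norm_num
  rw [Finset.powersetCard_one, Finset.filter_map, Finset.card_map]
  congr 1

theorem cnt_not {α : Type*} [Fintype α] (p : α → Prop) :
    cnt p + cnt (fun a => ¬ p a) = Fintype.card α := by
  rw [cnt_eq p, cnt_eq (fun a => ¬ p a)]
  exact_mod_cast Finset.card_filter_add_card_filter_not (s := Finset.univ) p

theorem act_insert (hH4 : ∀ e ∈ H, e.card = 4) {t : Finset V} (ht : t.card = 3) (h : Act H t) :
    ∃ u, insert u t ∈ H := by
  obtain ⟨f, hf, htf⟩ := h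
  have hc : (f \ t).card = 1 := by rw [Finset.card_sdiff_of_subset htf, hH4 f hf, ht]
  obtain ⟨u, hu⟩ := Finset.card_eq_one.1 hc
  refine ⟨u, ?_⟩
  have : insert u t = f := by
    rw [Finset.insert_eq, ← hu, Finset.sdiff_union_of_subset htf]
  rwa [this]

theorem act_deg (hH4 : ∀ e ∈ H, e.card = 4) {ε α : ℝ} (hd : IsDense 4 H (1 - ε) α)
    {t : Finset V} (ht : t.card = 3) (h : Act H t) :
    cnt (fun u => insert u t ∉ H) ≤ ε * Fintype.card V := by
  obtain ⟨u, hu⟩ := act_insert hH4 ht h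
  have h1 := (hd 3 (by norm_num) (by norm_num)).2 t ht
  have h2 : degT 4 H t ≠ 0 := by
    intro h0
    have h3 := degT3 (H := H) ht
    rw [h0] at h3
    have h4 : cnt (fun v : V => v ∈ ({u} : Finset V)) ≤ cnt (fun u => insert u t ∈ H) :=
      cnt_mono (fun a ha => by rw [Finset.mem_singleton] at ha; rwa [ha])
    rw [cnt_mem, ← h3] at h4
    norm_num at h4
  have h3 : ¬ ((degT 4 H t : ℝ) < (1 - ε) * ((Fintype.card V).choose (4 - 3))) := fun h => h2 (h1 h)
  rw [degT3 ht, not_lt] at h3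
  norm_num at h3
  have := cnt_not (fun u => insert u t ∈ H)
  linarith

theorem inact (hH4 : ∀ e ∈ H, e.card = 4) {ε α : ℝ} (hd : IsDense 4 H (1 - ε) α) (hε : ε < 1)
    (hα : 0 ≤ α) (hV : 0 < Fintype.card V) :
    cnt (fun p : (V × V) × V => ({p.1.1, p.1.2, p.2} : Finset V).card = 3 ∧
      ¬ Act H {p.1.1, p.1.2, p.2}) ≤ 27 * α * (Fintype.card V : ℝ) ^ 3 := by
  have h1 := (hd 3 (by norm_num) (by norm_num)).1
  rw [Set.ncard_eq_toFinset_card'] at h1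
  set B := ({S : Finset V | S.card = 3 ∧
        (degT 4 H S : ℝ) < (1 - ε) * ((Fintype.card V).choose (4 - 3))}).toFinset with hB
  have h2 : ((Fintype.card V).choose 3 : ℝ) ≤ (Fintype.card V : ℝ) ^ 3 := by
    exact_mod_cast Nat.choose_le_pow _ _
  have h3 : (B.card : ℝ) ≤ α * (Fintype.card V : ℝ) ^ 3 :=
    h1.trans (mul_le_mul_of_nonneg_left h2 hα)
  rw [cnt_eq]
  have h4 := Finset.card_le_mul_card_image_of_maps_to
    (s := Finset.univ.filter (fun p : (V × V) × V => ({p.1.1, p.1.2, p.2} : Finset V).card = 3 ∧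
      ¬ Act H {p.1.1, p.1.2, p.2})) (t := B) (f := fun p => {p.1.1, p.1.2, p.2})
    (by
      intro p hp
      rw [Finset.mem_filter] at hp
      rw [hB, Set.mem_toFinset]
      refine ⟨hp.2.1, ?_⟩
      rw [degT3 hp.2.1, cnt_eq_zero]
      · have : (0 : ℝ) < Fintype.card V := by exact_mod_cast hV
        norm_num
        exact mul_pos (by linarith) this
      · intro u hu
        exact hp.2.2 ⟨_, hu, Finset.subset_insert _ _⟩) 27
    (by
      intro b hb
      rw [hB, Set.mem_toFinset] at hb
      have : ((b ×ˢ b) ×ˢ b).card = 27 := by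
        rw [Finset.card_product, Finset.card_product, hb.1]
      rw [← this]
      apply Finset.card_le_card
      rintro ⟨⟨x, y⟩, z⟩ hp
      rw [Finset.mem_filter] at hp
      simp [← hp.2])
  have h5 : ((27 * B.card : ℕ) : ℝ) ≤ 27 * α * (Fintype.card V : ℝ) ^ 3 := by
    push_cast
    linarith
  exact le_trans (by exact_mod_cast h4) h5

theorem link (hH4 : ∀ e ∈ H, e.card = 4) (E : ℝ)
    (hE : ∀ t : Finset V, t.card = 3 → Act H t → cnt (fun u => insert u t ∉ H) ≤ E)
    (e : Finset V) (he : e.card = 2) :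
    ∃ (c : Bool) (k : (TG H cH).ConnectedComponent), ∀ v0, v0 ∉ e → Act H (insert v0 e) →
      cnt (fun v => ¬ Sh H cH (insert v e) c k) ≤ 2 * E := by
  by_cases hv : ∃ v0, v0 ∉ e ∧ Act H (insert v0 e)
  swap
  · exact ⟨true, K H cH ∅, fun v0 h1 h2 => absurd ⟨v0, h1, h2⟩ hv⟩
  obtain ⟨v0, hv0, hact⟩ := hv
  have ht3 : (insert v0 e).card = 3 := by rw [Finset.card_insert_of_notMem hv0, he]
  set t0 := insert v0 e with ht0
  have het0 : e ⊆ t0 := Finset.subset_insert _ _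
  have hk : ∀ c, ∃ k, ∀ f ∈ H, t0 ⊆ f → cH f = c → K H cH f = k := by
    intro c
    by_cases h : ∃ f ∈ H, t0 ⊆ f ∧ cH f = c
    · obtain ⟨f, hf, htf, hc⟩ := h
      exact ⟨K H cH f, fun g hg htg hgc =>
        K_eq_of_triple hH4 ht3 hg hf htg htf (hgc.trans hc.symm)⟩
    · exact ⟨K H cH ∅, fun g hg htg hgc => absurd ⟨g, hg, htg, hgc⟩ h⟩
  obtain ⟨kr, hkr⟩ := hk true
  obtain ⟨kb, hkb⟩ := hk false
  have hE0 := hE t0 ht3 hact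
  have hE1 : 0 ≤ E := (cnt_nonneg _).trans hE0
  have hsub : ∀ u, insert u e ⊆ insert u t0 := fun u => Finset.insert_subset_insert _ het0
  have hnot : ∀ {u t}, t.card = 3 → insert u t ∈ H → u ∉ t := by
    intro u t h3 hu hut
    rw [Finset.insert_eq_of_mem hut] at hu
    have := hH4 _ hu
    omega
  by_cases hall : ∀ u, insert u t0 ∈ H → Sh H cH (insert u e) false kb
  · refine ⟨false, kb, fun _ _ _ => ?_⟩
    have : cnt (fun v => ¬ Sh H cH (insert v e) false kb) ≤ cnt (fun u => insert u t0 ∉ H) :=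
      cnt_mono (fun u h h' => h (hall u h'))
    linarith
  · push Not at hall
    obtain ⟨p, hp, hpn⟩ := hall
    have hpe : p ∉ e := fun h => hnot ht3 hp (het0 h)
    have htp : (insert p e).card = 3 := by rw [Finset.card_insert_of_notMem hpe, he]
    have hpc : cH (insert p t0) = true := by
      by_contra hc
      rw [Bool.not_eq_true] at hc
      exact hpn ⟨_, hp, hsub p, hc, hkb _ hp (Finset.subset_insert _ _) hc⟩
    refine ⟨true, kr, fun _ _ _ => ?_⟩
    have h1 := hE _ htp ⟨_, hp, hsub p⟩
    have h2 := cnt_or (fun u => insert u t0 ∉ H) (fun u => insert u (insert p e) ∉ H)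
    refine (cnt_mono ?_).trans (h2.trans (by linarith))
    intro u hu
    by_contra hcon
    push Not at hcon
    obtain ⟨hu1, hu2⟩ := hcon
    apply hu
    have hue : insert u e ⊆ insert u (insert p e) :=
      Finset.insert_subset_insert _ (Finset.subset_insert _ _)
    cases hc1 : cH (insert u (insert p e)) with
    | true =>
      refine ⟨_, hu2, hue, hc1, ?_⟩
      rw [K_eq_of_triple hH4 htp hu2 hp (Finset.subset_insert _ _) (hsub p) (hc1.trans hpc.symm)]
      exact hkr _ hp (Finset.subset_insert _ _) hpc
    | false =>
      cases hc2 : cH (insert u t0) with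
      | true => exact ⟨_, hu1, hsub u, hc2, hkr _ hu1 (Finset.subset_insert _ _) hc2⟩
      | false =>
        exfalso
        have hu3 : (insert u e).card = 3 := by
          rw [Finset.card_insert_of_notMem (fun h => hnot ht3 hu1 (het0 h)), he]
        refine hpn ⟨_, hu2, Finset.subset_insert _ _, hc1, ?_⟩
        rw [K_eq_of_triple hH4 hu3 hu2 hu1 hue (hsub u) (hc1.trans hc2.symm)]
        exact hkb _ hu1 (Finset.subset_insert _ _) hc2

variable (col : Finset V → Bool) (comp : Finset V → (TG H cH).ConnectedComponent)

theorem cnt_perm1 (q : V → V → V → Prop) :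
    cnt (fun p : (V × V) × V => q p.1.1 p.2 p.1.2) ≤ cnt (fun p : (V × V) × V => q p.1.1 p.1.2 p.2) :=
  cnt_inj (fun p : (V × V) × V => ((p.1.1, p.2), p.1.2))
    (by rintro ⟨⟨_, _⟩, _⟩ ⟨⟨_, _⟩, _⟩ h; simp at h ⊢; tauto) (fun a h => h)

theorem cnt_perm2 (q : V → V → V → Prop) :
    cnt (fun p : (V × V) × V => q p.1.2 p.2 p.1.1) ≤ cnt (fun p : (V × V) × V => q p.1.1 p.1.2 p.2) :=
  cnt_inj (fun p : (V × V) × V => ((p.1.2, p.2), p.1.1))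
    (by rintro ⟨⟨_, _⟩, _⟩ ⟨⟨_, _⟩, _⟩ h; simp at h ⊢; tauto) (fun a h => h)

theorem cnt_fin_eq (x : V) : cnt (fun z => z = x) ≤ 1 := by
  have : cnt (fun z => z = x) ≤ cnt (fun z => z ∈ ({x} : Finset V)) :=
    cnt_mono (fun a h => by simpa using h)
  rw [cnt_mem] at this
  simpa using this

theorem rot1 (x y z : V) : insert z {x, y} = ({x, y, z} : Finset V) := by ext; simp; tauto

theorem rot2 (x y z : V) : insert y {x, z} = ({x, y, z} : Finset V) := by ext; simp; tauto

theorem pair_cases {x y z : V} {e : Finset V} (he : e ⊆ {x, y, z}) (h2 : e.card = 2) :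
    e = {x, y} ∨ e = {x, z} ∨ e = {y, z} := by
  obtain ⟨a, b, hab, rfl⟩ := Finset.card_eq_two.1 h2
  simp only [Finset.insert_subset_iff, Finset.singleton_subset_iff, Finset.mem_insert,
    Finset.mem_singleton] at he
  obtain ⟨rfl | rfl | rfl, rfl | rfl | rfl⟩ := he <;> simp_all [Finset.pair_comm]

/-- first goodness of triples -/
def G3' (t : Finset V) : Prop :=
  t.card = 3 ∧ ∀ e ⊆ t, e.card = 2 → Sh H cH t (col e) (comp e)

set_option maxHeartbeats 1000000 in
theorem bad3' {E I : ℝ} (hE0 : 0 ≤ E)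
    (hI : cnt (fun p : (V × V) × V => ({p.1.1, p.1.2, p.2} : Finset V).card = 3 ∧
      ¬ Act H {p.1.1, p.1.2, p.2}) ≤ I)
    (hl : ∀ e : Finset V, e.card = 2 → ∀ v0, v0 ∉ e → Act H (insert v0 e) →
      cnt (fun v => ¬ Sh H cH (insert v e) (col e) (comp e)) ≤ 2 * E) :
    cnt (fun p : (V × V) × V => ¬ G3' col comp {p.1.1, p.1.2, p.2}) ≤
      3 * (Fintype.card V : ℝ) ^ 2 + I + 6 * E * (Fintype.card V : ℝ) ^ 2 := by
  let q : V → V → V → Prop := fun x y z => z = x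
  let L : V → V → V → Prop := fun x y z => x ≠ y ∧ z ∉ ({x, y} : Finset V) ∧
    Act H (insert z {x, y}) ∧ ¬ Sh H cH (insert z {x, y}) (col {x, y}) (comp {x, y})
  have hcard : (Fintype.card (V × V) : ℝ) = (Fintype.card V : ℝ) ^ 2 := by
    rw [Fintype.card_prod]; push_cast; ring
  have hq : cnt (fun p : (V × V) × V => q p.1.1 p.1.2 p.2) ≤ (Fintype.card V : ℝ) ^ 2 := by
    have := fib_le (fun (p : V × V) z => q p.1 p.2 z) 1 (fun p => cnt_fin_eq p.1)
    rwa [hcard, mul_one] at this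
  have hL : cnt (fun p : (V × V) × V => L p.1.1 p.1.2 p.2) ≤ (Fintype.card V : ℝ) ^ 2 * (2 * E) := by
    have := fib_le (fun (p : V × V) z => L p.1 p.2 z) (2 * E) (by
      rintro ⟨x, y⟩
      by_cases h : ∃ z, L x y z
      · obtain ⟨z, h1, h2, h3, h4⟩ := h
        exact (cnt_mono (fun a h => h.2.2.2)).trans
          (hl {x, y} (Finset.card_pair h1) z h2 h3)
      · rw [cnt_eq_zero (fun z hz => h ⟨z, hz⟩)]
        linarith)
    rwa [hcard] at this
  have q2 := (cnt_perm1 q).trans hq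
  have q3 : cnt (fun p : (V × V) × V => p.2 = p.1.2) ≤ (Fintype.card V : ℝ) ^ 2 := by
    have := fib_le (fun (p : V × V) z => z = p.2) 1 (fun p => cnt_fin_eq p.2)
    rwa [hcard, mul_one] at this
  have L2 := (cnt_perm1 L).trans hL
  have L3 := (cnt_perm2 L).trans hL
  have key : ∀ p : (V × V) × V, ¬ G3' col comp {p.1.1, p.1.2, p.2} →
      (q p.1.1 p.1.2 p.2 ∨ (q p.1.1 p.2 p.1.2 ∨ p.2 = p.1.2)) ∨
      ((({p.1.1, p.1.2, p.2} : Finset V).card = 3 ∧ ¬ Act H {p.1.1, p.1.2, p.2}) ∨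
      (L p.1.1 p.1.2 p.2 ∨ (L p.1.1 p.2 p.1.2 ∨ L p.1.2 p.2 p.1.1))) := by
    rintro ⟨⟨x, y⟩, z⟩ hb
    simp only at hb ⊢
    by_contra hcon
    simp only [not_or] at hcon
    obtain ⟨⟨h1, h2, h3⟩, h4, h5, h6, h7⟩ := hcon
    simp only [q] at h1 h2
    have hc3 : ({x, y, z} : Finset V).card = 3 :=
      Finset.card_eq_three.2 ⟨x, y, z, Ne.symm h2, Ne.symm h1, Ne.symm h3, rfl⟩
    have hact : Act H {x, y, z} := by
      by_contra h
      exact h4 ⟨hc3, h⟩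
    have e1 := rot1 x y z
    have e2 := rot2 x y z
    have e3 : insert x {y, z} = ({x, y, z} : Finset V) := rfl
    simp only [L, e1, e2, e3] at h5 h6 h7
    refine hb ⟨hc3, fun e he he2 => ?_⟩
    rcases pair_cases he he2 with rfl | rfl | rfl
    · by_contra h
      exact h5 ⟨Ne.symm h2, by simp [h1, h3], hact, h⟩
    · by_contra h
      exact h6 ⟨Ne.symm h1, by simp [h2, Ne.symm h3], hact, h⟩
    · by_contra h
      exact h7 ⟨Ne.symm h3, by simp [Ne.symm h1, Ne.symm h2], hact, h⟩
  refine (cnt_mono key).trans ?_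
  refine (cnt_or _ _).trans ?_
  have r1 := cnt_or (fun p : (V × V) × V => q p.1.1 p.1.2 p.2)
    (fun p => q p.1.1 p.2 p.1.2 ∨ p.2 = p.1.2)
  have r2 := cnt_or (fun p : (V × V) × V => q p.1.1 p.2 p.1.2) (fun p => p.2 = p.1.2)
  have r3 := cnt_or (fun p : (V × V) × V => ({p.1.1, p.1.2, p.2} : Finset V).card = 3 ∧
    ¬ Act H {p.1.1, p.1.2, p.2}) (fun p => L p.1.1 p.1.2 p.2 ∨ (L p.1.1 p.2 p.1.2 ∨ L p.1.2 p.2 p.1.1))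
  have r4 := cnt_or (fun p : (V × V) × V => L p.1.1 p.1.2 p.2)
    (fun p => L p.1.1 p.2 p.1.2 ∨ L p.1.2 p.2 p.1.1)
  have r5 := cnt_or (fun p : (V × V) × V => L p.1.1 p.2 p.1.2) (fun p => L p.1.2 p.2 p.1.1)
  linarith

variable (c0 : Bool) (k0 : (TG H cH).ConnectedComponent)

/-- goodness of triples -/
def G3 (t : Finset V) : Prop :=
  t.card = 3 ∧ ∀ e ⊆ t, e.card = 2 → Sh H cH t (col e) (comp e) ∧ (col e = c0 → comp e = k0)

theorem G3'_inc (hH4 : ∀ e ∈ H, e.card = 4) {t : Finset V} (ht : G3' col comp t) {e e' : Finset V}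
    (he : e ⊆ t) (he' : e' ⊆ t) (h2 : e.card = 2) (h2' : e'.card = 2) (hc : col e = col e') :
    comp e = comp e' := by
  obtain ⟨f, hf, htf, hfc, hfk⟩ := ht.2 e he h2
  obtain ⟨g, hg, htg, hgc, hgk⟩ := ht.2 e' he' h2'
  rw [← hfk, ← hgk]
  exact K_eq_of_triple hH4 ht.1 hf hg htf htg (by rw [hfc, hgc, hc])

theorem G3.to {t : Finset V} (h : G3 col comp c0 k0 t) : G3' col comp t :=
  ⟨h.1, fun e he h2 => (h.2 e he h2).1⟩

theorem G3'_dist {x y z : V} (h : ({x, y, z} : Finset V).card = 3) : x ≠ y ∧ x ≠ z ∧ y ≠ z := by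
  refine ⟨?_, ?_, ?_⟩ <;> rintro rfl
  · have : ({x, x, z} : Finset V) = {x, z} := by ext; simp
    rw [this] at h
    have := Finset.card_le_two (a := x) (b := z)
    omega
  · have : ({x, y, x} : Finset V) = {x, y} := by ext; simp; tauto
    rw [this] at h
    have := Finset.card_le_two (a := x) (b := y)
    omega
  · have : ({x, y, y} : Finset V) = {x, y} := by ext; simp
    rw [this] at h
    have := Finset.card_le_two (a := x) (b := y)
    omega

theorem dom3 (hH4 : ∀ e ∈ H, e.card = 4) {δ : ℝ} (hδ : 0 < δ)
    (hb : cnt (fun p : (V × V) × V => ¬ G3' col comp {p.1.1, p.1.2, p.2}) ≤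
      δ ^ 3 / 7 * (Fintype.card V : ℝ) ^ 3) :
    ∃ c0 k0, cnt (fun p : (V × V) × V => ¬ G3 col comp c0 k0 {p.1.1, p.1.2, p.2}) ≤
      (δ ^ 3 / 7 + 3 * δ) * (Fintype.card V : ℝ) ^ 3 := by
  have : Nonempty (TG H cH).ConnectedComponent := ⟨K H cH ∅⟩
  obtain ⟨c0, k0, h0⟩ := dominate col comp (fun x y z => ¬ G3' col comp {x, y, z}) (by
    intro a b c h
    rw [not_not] at h
    obtain ⟨d1, d2, d3⟩ := G3'_dist h.1
    have i1 : ({a, b} : Finset V) ⊆ {a, b, c} := by intro; simp; tauto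
    have i2 : ({a, c} : Finset V) ⊆ {a, b, c} := by intro; simp; tauto
    have i3 : ({b, c} : Finset V) ⊆ {a, b, c} := by intro; simp; tauto
    exact ⟨G3'_inc col comp hH4 h i1 i2 (Finset.card_pair d1) (Finset.card_pair d2),
      G3'_inc col comp hH4 h i1 i3 (Finset.card_pair d1) (Finset.card_pair d3),
      G3'_inc col comp hH4 h i2 i3 (Finset.card_pair d2) (Finset.card_pair d3)⟩) δ hδ hb
  refine ⟨c0, k0, ?_⟩
  let P : V → V → V → Prop := fun x y _ => col {x, y} = c0 ∧ comp {x, y} ≠ k0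
  have hP : cnt (fun p : (V × V) × V => P p.1.1 p.1.2 p.2) ≤ δ * (Fintype.card V : ℝ) ^ 3 := by
    have h1 : cnt (fun p : (V × V) × V => P p.1.1 p.1.2 p.2) ≤
        cnt (fun p : V × (V × V) => P p.2.1 p.2.2 p.1) :=
      cnt_inj (fun p => (p.2, p.1))
        (by rintro ⟨⟨_, _⟩, _⟩ ⟨⟨_, _⟩, _⟩ h; simp at h ⊢; tauto) (fun a h => h)
    have h2 := fib_le (fun (z : V) (p : V × V) => P p.1 p.2 z) _ (fun z => h0)
    refine h1.trans (h2.trans (le_of_eq (by ring)))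
  have P2 := (cnt_perm1 P).trans hP
  have P3 := (cnt_perm2 P).trans hP
  have key : ∀ p : (V × V) × V, ¬ G3 col comp c0 k0 {p.1.1, p.1.2, p.2} →
      (¬ G3' col comp {p.1.1, p.1.2, p.2}) ∨
      (P p.1.1 p.1.2 p.2 ∨ (P p.1.1 p.2 p.1.2 ∨ P p.1.2 p.2 p.1.1)) := by
    rintro ⟨⟨x, y⟩, z⟩ hb
    simp only at hb ⊢
    by_contra hcon
    simp only [not_or, not_not, P, not_and] at hcon
    obtain ⟨h1, h2, h3, h4⟩ := hcon
    refine hb ⟨h1.1, fun e he he2 => ⟨h1.2 e he he2, ?_⟩⟩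
    rcases pair_cases he he2 with rfl | rfl | rfl <;> assumption
  refine (cnt_mono key).trans ?_
  refine (cnt_or _ _).trans ?_
  have r4 := cnt_or (fun p : (V × V) × V => P p.1.1 p.1.2 p.2)
    (fun p => P p.1.1 p.2 p.1.2 ∨ P p.1.2 p.2 p.1.1)
  have r5 := cnt_or (fun p : (V × V) × V => P p.1.1 p.2 p.1.2) (fun p => P p.1.2 p.2 p.1.1)
  linarith

variable (ρ : ℝ)

/-- goodness of pairs -/
def G2 (e : Finset V) : Prop :=
  e.card = 2 ∧ cnt (fun z => z ∉ e ∧ ¬ G3 col comp c0 k0 (insert z e)) ≤ ρ ^ 2 * Fintype.card V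

/-- goodness of vertices -/
def G1 (s : Finset V) : Prop :=
  cnt (fun y => y ∉ s ∧ ¬ G2 col comp c0 k0 ρ (insert y s)) ≤ ρ * Fintype.card V

theorem bad2 (hρ : 0 < ρ) (hn : 0 < (Fintype.card V : ℝ))
    (hb : cnt (fun p : (V × V) × V => ¬ G3 col comp c0 k0 {p.1.1, p.1.2, p.2}) ≤
      ρ ^ 4 * (Fintype.card V : ℝ) ^ 3) :
    cnt (fun p : V × V => p.1 ≠ p.2 ∧ ¬ G2 col comp c0 k0 ρ {p.1, p.2}) ≤
      ρ ^ 2 * (Fintype.card V : ℝ) ^ 2 := by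
  have h1 := fib (fun (p : V × V) z => ¬ G3 col comp c0 k0 {p.1, p.2, z})
    (fun p : V × V => p.1 ≠ p.2 ∧ ¬ G2 col comp c0 k0 ρ {p.1, p.2}) (ρ ^ 2 * Fintype.card V) (by
      rintro ⟨x, y⟩ ⟨hxy, hg⟩
      simp only at hxy hg ⊢
      by_contra hcon
      refine hg ⟨Finset.card_pair hxy, ?_⟩
      rw [not_le] at hcon
      refine (cnt_mono ?_).trans hcon.le
      rintro z ⟨_, hz⟩
      have e1 := rot1 x y z
      rwa [e1] at hz)
  have h2 := h1.trans hb
  have h3 : 0 < ρ ^ 2 * (Fintype.card V : ℝ) := by positivity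
  refine le_of_mul_le_mul_right (h2.trans (le_of_eq ?_)) h3
  ring

theorem bad1 (hρ : 0 < ρ) (hn : 0 < (Fintype.card V : ℝ))
    (hb : cnt (fun p : V × V => p.1 ≠ p.2 ∧ ¬ G2 col comp c0 k0 ρ {p.1, p.2}) ≤
      ρ ^ 2 * (Fintype.card V : ℝ) ^ 2) :
    cnt (fun x : V => ¬ G1 col comp c0 k0 ρ {x}) ≤ ρ * (Fintype.card V : ℝ) := by
  have h1 := fib (fun (x y : V) => x ≠ y ∧ ¬ G2 col comp c0 k0 ρ {x, y})
    (fun x : V => ¬ G1 col comp c0 k0 ρ {x}) (ρ * Fintype.card V) (by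
      rintro x hg
      by_contra hcon
      refine hg ?_
      rw [not_le] at hcon
      refine (cnt_mono ?_).trans hcon.le
      rintro y ⟨hy, hz⟩
      rw [Finset.pair_comm] at hz
      exact ⟨by rintro rfl; simp at hy, hz⟩)
  have h2 := h1.trans hb
  have h3 : 0 < ρ * (Fintype.card V : ℝ) := by positivity
  refine le_of_mul_le_mul_right (h2.trans (le_of_eq ?_)) h3
  ring

/-- goodness of sets -/
def Ok (s : Finset V) : Prop :=
  (s.card = 1 → G1 col comp c0 k0 ρ s) ∧ (s.card = 2 → G2 col comp c0 k0 ρ s) ∧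
  (s.card = 3 → G3 col comp c0 k0 s) ∧ (s.card = 4 → s ∈ H)

theorem okstep (hρ : 0 < ρ) (hρ1 : ρ ≤ 1) {E : ℝ} (hEρ : E ≤ ρ * Fintype.card V)
    (hE : ∀ t : Finset V, t.card = 3 → Act H t → cnt (fun u => insert u t ∉ H) ≤ E)
    (hb : cnt (fun x : V => ¬ G1 col comp c0 k0 ρ {x}) ≤ ρ * (Fintype.card V : ℝ))
    {s : Finset V} (hs : Ok col comp c0 k0 ρ s) :
    cnt (fun v => v ∉ s ∧ ¬ Ok col comp c0 k0 ρ (insert v s)) ≤ ρ * (Fintype.card V : ℝ) := by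
  have hn : (0 : ℝ) ≤ Fintype.card V := Nat.cast_nonneg _
  obtain ⟨h1, h2, h3, h4⟩ := hs
  have hcase : s.card = 0 ∨ s.card = 1 ∨ s.card = 2 ∨ s.card = 3 ∨ 4 ≤ s.card := by omega
  rcases hcase with h | h | h | h | h
  · rw [Finset.card_eq_zero] at h
    subst h
    refine (cnt_mono ?_).trans hb
    rintro v ⟨hv, hok⟩ hg
    exact hok ⟨fun _ => hg, by simp, by simp, by simp⟩
  · refine (cnt_mono ?_).trans (h1 h)
    rintro v ⟨hv, hok⟩
    refine ⟨hv, fun hg => hok ?_⟩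
    have hc := Finset.card_insert_of_notMem hv
    exact ⟨fun _ => by omega, fun _ => hg, fun _ => by omega, fun _ => by omega⟩
  · refine (cnt_mono ?_).trans ((h2 h).2.trans ?_)
    · rintro v ⟨hv, hok⟩
      refine ⟨hv, fun hg => hok ?_⟩
      have hc := Finset.card_insert_of_notMem hv
      exact ⟨fun _ => by omega, fun _ => by omega, fun _ => hg, fun _ => by omega⟩
    · exact mul_le_mul_of_nonneg_right (by nlinarith) hn
  · have hact : Act H s := by
      obtain ⟨e, he, he2⟩ := Finset.exists_subset_card_eq (s := s) (n := 2) (by omega)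
      obtain ⟨f, hf, hsf, _⟩ := ((h3 h).2 e he he2).1
      exact ⟨f, hf, hsf⟩
    refine (cnt_mono ?_).trans ((hE s h hact).trans hEρ)
    rintro v ⟨hv, hok⟩ hg
    have hc := Finset.card_insert_of_notMem hv
    exact hok ⟨fun _ => by omega, fun _ => by omega, fun _ => by omega, fun _ => hg⟩
  · rw [cnt_eq_zero]
    · positivity
    · rintro v ⟨hv, hok⟩
      have hc := Finset.card_insert_of_notMem hv
      exact hok ⟨fun _ => by omega, fun _ => by omega, fun _ => by omega, fun _ => by omega⟩

/-- hereditary goodness -/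
def Cl (A : Finset V) : Prop := ∀ s ⊆ A, Ok col comp c0 k0 ρ s

theorem ext1 (hρ : 0 < ρ)
    (hst : ∀ s, Ok col comp c0 k0 ρ s →
      cnt (fun v => v ∉ s ∧ ¬ Ok col comp c0 k0 ρ (insert v s)) ≤ ρ * (Fintype.card V : ℝ))
    {A : Finset V} (hA : Cl col comp c0 k0 ρ A) (hA9 : A.card ≤ 9) :
    cnt (fun v => v ∈ A ∨ ¬ Cl col comp c0 k0 ρ (insert v A)) ≤ 9 + 512 * (ρ * Fintype.card V) := by
  have h1 := cnt_bex A.powerset (fun s v => v ∉ s ∧ ¬ Ok col comp c0 k0 ρ (insert v s))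
    (ρ * Fintype.card V) (fun s hs => hst s (hA s (Finset.mem_powerset.1 hs)))
  have h2 := cnt_or (fun v => v ∈ A)
    (fun v => ∃ s ∈ A.powerset, v ∉ s ∧ ¬ Ok col comp c0 k0 ρ (insert v s))
  have h3 : cnt (fun v => v ∈ A ∨ ¬ Cl col comp c0 k0 ρ (insert v A)) ≤ cnt (fun v => v ∈ A ∨
      ∃ s ∈ A.powerset, v ∉ s ∧ ¬ Ok col comp c0 k0 ρ (insert v s)) := by
    apply cnt_mono
    rintro v (hv | hv)
    · exact Or.inl hv
    · right
      unfold Cl at hv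
      push Not at hv
      obtain ⟨s, hs, hn⟩ := hv
      have hvs : v ∈ s := by
        by_contra h
        exact hn (hA s ((Finset.subset_insert_iff_of_notMem h).1 hs))
      refine ⟨s.erase v, ?_, Finset.notMem_erase _ _, by rwa [Finset.insert_erase hvs]⟩
      rw [Finset.mem_powerset]
      exact Finset.subset_insert_iff.1 hs
  rw [cnt_mem] at h2
  have h4 : (A.powerset.card : ℝ) ≤ 512 := by
    rw [Finset.card_powerset]
    have : 2 ^ A.card ≤ 2 ^ 9 := Nat.pow_le_pow_right (by norm_num) hA9
    exact_mod_cast this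
  have h5 : (A.card : ℝ) ≤ 9 := by exact_mod_cast hA9
  have h6 : 0 ≤ ρ * (Fintype.card V : ℝ) := by positivity
  nlinarith

theorem extm (hρ : 0 < ρ)
    (hst : ∀ s, Ok col comp c0 k0 ρ s →
      cnt (fun v => v ∉ s ∧ ¬ Ok col comp c0 k0 ρ (insert v s)) ≤ ρ * (Fintype.card V : ℝ))
    {A B W : Finset V} (hA : Cl col comp c0 k0 ρ A) (hB : Cl col comp c0 k0 ρ B)
    (hA6 : A.card ≤ 6) (hB6 : B.card ≤ 6)
    (hW : 18 + 1024 * (ρ * (Fintype.card V : ℝ)) < W.card) (m : ℕ) (hm : m ≤ 4) :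
    ∃ U ⊆ W, U.card = m ∧ Disjoint U A ∧ Disjoint U B ∧ Cl col comp c0 k0 ρ (A ∪ U) ∧
      Cl col comp c0 k0 ρ (B ∪ U) := by
  induction m with
  | zero => exact ⟨∅, by simp, by simp, by simp, by simp, by simpa using hA, by simpa using hB⟩
  | succ m ih =>
    obtain ⟨U, hUW, hUm, dA, dB, cA, cB⟩ := ih (by omega)
    have a1 := ext1 col comp c0 k0 ρ hρ hst cA ((Finset.card_union_le _ _).trans (by omega))
    have b1 := ext1 col comp c0 k0 ρ hρ hst cB ((Finset.card_union_le _ _).trans (by omega))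
    have hex : ∃ v ∈ W, ¬ ((v ∈ A ∪ U ∨ ¬ Cl col comp c0 k0 ρ (insert v (A ∪ U))) ∨
        (v ∈ B ∪ U ∨ ¬ Cl col comp c0 k0 ρ (insert v (B ∪ U)))) := by
      by_contra hcon
      push Not at hcon
      have h1 : cnt (fun v => v ∈ W) ≤ _ := cnt_mono (fun v hv => hcon v hv)
      rw [cnt_mem] at h1
      have h2 := cnt_or (fun v => (v ∈ A ∪ U ∨ ¬ Cl col comp c0 k0 ρ (insert v (A ∪ U))))
        (fun v => (v ∈ B ∪ U ∨ ¬ Cl col comp c0 k0 ρ (insert v (B ∪ U))))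
      linarith
    obtain ⟨v, hvW, hv⟩ := hex
    simp only [not_or, not_not, Finset.mem_union] at hv
    obtain ⟨⟨⟨n1, n2⟩, n3⟩, ⟨n4, _⟩, n5⟩ := hv
    refine ⟨insert v U, Finset.insert_subset hvW hUW, ?_, ?_, ?_, ?_, ?_⟩
    · rw [Finset.card_insert_of_notMem n2, hUm]
    · rw [Finset.disjoint_insert_left]; exact ⟨n1, dA⟩
    · rw [Finset.disjoint_insert_left]; exact ⟨n4, dB⟩
    · rwa [Finset.union_insert]
    · rwa [Finset.union_insert]

theorem mkSys (hH4 : ∀ e ∈ H, e.card = 4) {E I δ : ℝ} (T : ℕ) (hE0 : 0 ≤ E)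
    (hE : ∀ t : Finset V, t.card = 3 → Act H t → cnt (fun u => insert u t ∉ H) ≤ E)
    (hI : cnt (fun p : (V × V) × V => ({p.1.1, p.1.2, p.2} : Finset V).card = 3 ∧
      ¬ Act H {p.1.1, p.1.2, p.2}) ≤ I)
    (hρ : 0 < ρ) (hρ1 : ρ ≤ 1) (hδ : 0 < δ) (hn : 0 < (Fintype.card V : ℝ))
    (hbad : 3 * (Fintype.card V : ℝ) ^ 2 + I + 6 * E * (Fintype.card V : ℝ) ^ 2 ≤
      δ ^ 3 / 7 * (Fintype.card V : ℝ) ^ 3)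
    (hδρ : δ ^ 3 / 7 + 3 * δ ≤ ρ ^ 4) (hEρ : E ≤ ρ * Fintype.card V)
    (hT : 18 + 1024 * (ρ * (Fintype.card V : ℝ)) < T)
    (h2 : 2 + ρ * (Fintype.card V : ℝ) < Fintype.card V) : Nonempty (Sys H cH T) := by
  have hl : ∀ e : Finset V, ∃ (c : Bool) (k : (TG H cH).ConnectedComponent), e.card = 2 →
      ∀ v0, v0 ∉ e → Act H (insert v0 e) →
      cnt (fun v => ¬ Sh H cH (insert v e) c k) ≤ 2 * E := by
    intro e
    by_cases he : e.card = 2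
    · obtain ⟨c, k, h⟩ := link (cH := cH) hH4 E hE e he
      exact ⟨c, k, fun _ => h⟩
    · exact ⟨true, K H cH ∅, fun h => absurd h he⟩
  choose col comp hl using hl
  have hb3 := (bad3' col comp hE0 hI hl).trans hbad
  obtain ⟨c0, k0, hb⟩ := dom3 col comp hH4 hδ hb3
  have hb' := hb.trans (mul_le_mul_of_nonneg_right hδρ (by positivity))
  have hb1 := bad1 col comp c0 k0 ρ hρ hn (bad2 col comp c0 k0 ρ hρ hn hb')
  have hst := fun s => okstep col comp c0 k0 ρ hρ hρ1 hEρ hE hb1 (s := s)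
  exact ⟨{
    hH4 := hH4
    Clean := Cl col comp c0 k0 ρ
    col := col
    comp := comp
    c0 := c0
    k0 := k0
    hempty := by
      intro s hs
      rw [Finset.subset_empty] at hs
      subst hs
      exact ⟨by simp, by simp, by simp, by simp⟩
    hmono := fun A B hAB hB s hs => hB s (hs.trans hAB)
    hExt := by
      intro A B W hA hB hA6 hB6 hW
      refine extm col comp c0 k0 ρ hρ hst hA hB hA6 hB6 (hT.trans_le ?_) 4 le_rfl
      exact_mod_cast hW
    hH := fun f hf h4 => (hf f (Finset.Subset.refl _)).2.2.2 h4
    hK := by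
      intro f e hf hef he2 hf4 hc
      obtain ⟨v, hv⟩ : (f \ e).Nonempty := by
        rw [← Finset.card_pos, Finset.card_sdiff_of_subset hef]; omega
      rw [Finset.mem_sdiff] at hv
      have ht3 : (insert v e).card = 3 := by rw [Finset.card_insert_of_notMem hv.2, he2]
      have hsub : insert v e ⊆ f := Finset.insert_subset hv.1 hef
      obtain ⟨g, hg, htg, hgc, hgk⟩ := (((hf _ hsub).2.2.1 ht3).2 e (Finset.subset_insert _ _) he2).1
      rw [← hgk]
      exact K_eq_of_triple hH4 ht3 ((hf f (Finset.Subset.refl _)).2.2.2 hf4) hg hsub htg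
        (hc.trans hgc.symm)
    hinc := by
      intro x y z hcl hxy hxz hyz hc
      have hc3 : ({x, y, z} : Finset V).card = 3 :=
        Finset.card_eq_three.2 ⟨x, y, z, hxy, hxz, hyz, rfl⟩
      have hg := (hcl _ (Finset.Subset.refl _)).2.2.1 hc3
      exact G3'_inc col comp hH4 (hg.to) (by intro; simp; tauto) (by intro; simp; tauto)
        (Finset.card_pair hxy) (Finset.card_pair hxz) hc
    hc0 := by
      intro e hcl he2 hc
      have hg := ((hcl _ (Finset.Subset.refl _)).2.1 he2).2
      by_contra hcon
      have h5 := cnt_or (fun z => z ∈ e) (fun z => z ∉ e ∧ ¬ G3 col comp c0 k0 (insert z e))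
      have h6 : cnt (fun _ : V => True) ≤
          cnt (fun z => z ∈ e ∨ (z ∉ e ∧ ¬ G3 col comp c0 k0 (insert z e))) := by
        apply cnt_mono
        intro z _
        by_cases hz : z ∈ e
        · exact Or.inl hz
        · refine Or.inr ⟨hz, fun hg3 => hcon ?_⟩
          exact (hg3.2 e (Finset.subset_insert _ _) he2).2 hc
      rw [cnt_mem, he2] at h5
      rw [cnt_true] at h6
      push_cast at h5
      have : ρ ^ 2 * (Fintype.card V : ℝ) ≤ ρ * Fintype.card V :=
        mul_le_mul_of_nonneg_right (by nlinarith) hn.le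
      linarith }⟩

end dense

theorem final (η : ℝ) (hη0 : 0 < η) (hη1 : η < 1) :
    ∃ α₀ : ℝ, 0 < α₀ ∧ ∀ α : ℝ, 0 < α → α ≤ α₀ → ∀ ε : ℝ, 0 < ε → ε ≤ α₀ →
        ∃ n₀ : ℕ, ∀ n : ℕ, n₀ ≤ n →
          ∀ (H : Finset (Finset (Fin n))) (cH : Finset (Fin n) → Bool),
            (∀ e ∈ H, e.card = 4) → IsDense 4 H (1 - ε) α →
            ∃ MR MB : Finset (Finset (Fin n)),
              IsTCMatching 4 (H.filter (fun f => cH f = true)) MR ∧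
              IsTCMatching 4 (H.filter (fun f => cH f = false)) MB ∧
              Disjoint (MR.biUnion id) (MB.biUnion id) ∧
              (n : ℝ) - 3 * η * n ≤ ((MR.biUnion id ∪ MB.biUnion id).card : ℝ) := by
  obtain ⟨ρ, hρ⟩ : ∃ ρ, ρ = η / 1000 := ⟨_, rfl⟩
  obtain ⟨δ, hδ⟩ : ∃ δ, δ = ρ ^ 4 / 4 := ⟨_, rfl⟩
  obtain ⟨β, hβ⟩ : ∃ β, β = δ ^ 3 / 7 := ⟨_, rfl⟩
  have hρ0 : 0 < ρ := by rw [hρ]; positivity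
  have hρ1 : ρ ≤ 1 / 1000 := by rw [hρ]; linarith
  have hδ0 : 0 < δ := by rw [hδ]; positivity
  have hρ4 : ρ ^ 4 ≤ ρ := by
    have : ρ ^ 4 ≤ ρ ^ 1 := pow_le_pow_of_le_one hρ0.le (by linarith) (by norm_num)
    simpa using this
  have hδ1 : δ ≤ 1 := by linarith
  have hδρ : δ ≤ ρ := by linarith
  have hβ0 : 0 < β := by rw [hβ]; positivity
  have hβδ : β ≤ δ := by
    have : δ ^ 3 ≤ δ ^ 1 := pow_le_pow_of_le_one hδ0.le hδ1 (by norm_num)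
    rw [pow_one] at this
    linarith
  refine ⟨β / 100, by positivity, fun α hα0 hα ε hε0 hε => ?_⟩
  obtain ⟨N, hN⟩ := exists_nat_gt (100 / β + 100 / η)
  refine ⟨N, fun n hn H cH hH4 hd => ?_⟩
  have hnN : 100 / β + 100 / η < n := hN.trans_le (by exact_mod_cast hn)
  have p1 : 0 < 100 / β := by positivity
  have p2 : 0 < 100 / η := by positivity
  have hnβ : 100 < n * β := (div_lt_iff₀ hβ0).1 (by linarith)
  have hnη : 100 < n * η := (div_lt_iff₀ hη0).1 (by linarith)
  have hn0 : (0 : ℝ) < n := by linarith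
  have hn100 : (100 : ℝ) < n := by nlinarith
  have hcard : (Fintype.card (Fin n) : ℝ) = n := by simp
  have hS : Nonempty (Sys H cH ⌈3 * η * n⌉₊) := by
    refine mkSys (E := ε * n) (I := 27 * α * (n : ℝ) ^ 3) (δ := δ) ρ hH4 _ (by positivity) ?_ ?_ hρ0
      (by linarith) hδ0 (by rwa [hcard]) ?_ (by linarith) ?_ ?_ ?_
    · intro t ht hact
      have := act_deg hH4 hd ht hact
      rwa [hcard] at this
    · have := inact hH4 hd (by linarith) hα0.le (by
        rw [Fintype.card_fin]; exact_mod_cast hn0)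
      rwa [hcard] at this
    · rw [hcard, ← hβ]
      have h3 : (0 : ℝ) < n ^ 3 := by positivity
      have a1 : 27 * α * (n : ℝ) ^ 3 ≤ 27 * (β / 100) * n ^ 3 :=
        mul_le_mul_of_nonneg_right (by linarith) h3.le
      have a2 : 6 * (ε * n) * (n : ℝ) ^ 2 ≤ 6 * (β / 100) * n ^ 3 := by
        have : 6 * (ε * n) * (n : ℝ) ^ 2 = 6 * ε * n ^ 3 := by ring
        rw [this]
        exact mul_le_mul_of_nonneg_right (by linarith) h3.le
      have a3 : 100 * (n : ℝ) ^ 2 ≤ β * n ^ 3 := by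
        have : β * (n : ℝ) ^ 3 = (n * β) * n ^ 2 := by ring
        rw [this]
        exact mul_le_mul_of_nonneg_right hnβ.le (by positivity)
      have h4 : 0 < β * (n : ℝ) ^ 3 := by positivity
      linarith
    · rw [hcard]
      exact mul_le_mul_of_nonneg_right (by linarith) hn0.le
    · rw [hcard]
      refine lt_of_lt_of_le ?_ (Nat.le_ceil _)
      rw [hρ]
      linarith
    · rw [hcard]
      have : ρ * n ≤ 1 / 1000 * n := mul_le_mul_of_nonneg_right hρ1 hn0.le
      linarith
  obtain ⟨S⟩ := hS
  obtain ⟨F, hFH, hFm, hFK, hFl⟩ := S.core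
  have hl : ((left F).card : ℝ) < 3 * η * n := Nat.lt_ceil.1 hFl
  have hTC : ∀ c : Bool, IsTCMatching 4 (H.filter (fun f => cH f = c)) (F.filter (fun f => cH f = c)) := by
    intro c
    refine ⟨Finset.filter_subset_filter _ hFH, ?_, ?_⟩
    · intro e he f hf hef
      exact hFm e (Finset.mem_filter.1 he).1 f (Finset.mem_filter.1 hf).1 hef
    · intro e he f hf
      rw [Finset.mem_filter] at he hf
      exact tightConn_of_K (hFH he.1) he.2 (hFK e he.1 f hf.1 (he.2.trans hf.2.symm))
  refine ⟨F.filter (fun f => cH f = true), F.filter (fun f => cH f = false), hTC true, hTC false, ?_, ?_⟩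
  · rw [Finset.disjoint_biUnion_left]
    intro e he
    rw [Finset.disjoint_biUnion_right]
    intro f hf
    rw [Finset.mem_filter] at he hf
    refine hFm e he.1 f hf.1 ?_
    rintro rfl
    rw [he.2] at hf
    simp at hf
  · have hu : (F.filter (fun f => cH f = true)).biUnion id ∪ (F.filter (fun f => cH f = false)).biUnion id
        = F.biUnion id := by
      rw [← Finset.union_biUnion]
      congr 1
      ext f
      simp only [Finset.mem_union, Finset.mem_filter]
      cases cH f <;> simp
    rw [hu]
    have : (left F).card + (F.biUnion id).card = n := by
      have := Finset.card_sdiff_add_card_eq_card (Finset.subset_univ (F.biUnion id))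
      rwa [Finset.card_univ, Fintype.card_fin] at this
    have h' : ((left F).card : ℝ) + (F.biUnion id).card = n := by exact_mod_cast this
    linarith
end TCM

/-- For every `0 < η < 1` there is `α₀ > 0` such that for every `0 < α ≤ α₀` there is
`ε₀ > 0` such that for every `0 < ε ≤ ε₀` there is `n₀` such that for all `n ≥ n₀`: every
2-edge-coloured `(1-ε, α)`-dense 4-graph `H` on `n` vertices contains a red tightly connected
matching and a blue tightly connected matching that are vertex-disjoint and together cover
all but at most `3ηn` vertices. -/
theorem stmt16 (η : ℝ) (hη0 : 0 < η) (hη1 : η < 1) :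
    ∃ α₀ : ℝ, 0 < α₀ ∧ ∀ α : ℝ, 0 < α → α ≤ α₀ →
      ∃ ε₀ : ℝ, 0 < ε₀ ∧ ∀ ε : ℝ, 0 < ε → ε ≤ ε₀ →
        ∃ n₀ : ℕ, ∀ n : ℕ, n₀ ≤ n →
          ∀ (H : Finset (Finset (Fin n))) (cH : Finset (Fin n) → Bool),
            (∀ e ∈ H, e.card = 4) → IsDense 4 H (1 - ε) α →
            ∃ MR MB : Finset (Finset (Fin n)),
              IsTCMatching 4 (H.filter (fun f => cH f = true)) MR ∧
              IsTCMatching 4 (H.filter (fun f => cH f = false)) MB ∧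
              Disjoint (MR.biUnion id) (MB.biUnion id) ∧
              (n : ℝ) - 3 * η * n ≤ ((MR.biUnion id ∪ MB.biUnion id).card : ℝ) := by
  obtain ⟨a, ha, h⟩ := TCM.final η hη0 hη1
  exact ⟨a, ha, fun α h1 h2 => ⟨a, ha, h α h1 h2⟩⟩
end

section
/- For every η with 0 < η < 1 there exists α_0 > 0 such that for every 0 < α ≤ α_0 there exists ε_0 > 0 such that for every 0 < ε ≤ ε_0 there exists n_0 such that for all n ≥ n_0 the following holds: every 2-edge-coloured (1−ε, α)-dense 5-graph H on n vertices contains four monochromatic tightly connected matchings that are pairwise vertex-disjoint and whose union covers all but at most 3ηn of the vertices of H. -/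
open Finset

section aux
open scoped Classical

def Cx {V : Type*} [Fintype V] [DecidableEq V] (K : Set (Finset V)) (δ : ℝ) : Prop :=
  ∅ ∈ K ∧ (∀ S ∈ K, ∀ T, T ⊆ S → T ∈ K) ∧
  ∀ S ∈ K, S.card ≤ 4 →
    ((univ.filter fun v => insert v S ∉ K).card : ℝ) ≤ δ * Fintype.card V

def badS {V : Type*} [Fintype V] [DecidableEq V] (K : Set (Finset V)) (θ : ℝ)
    (bd : Finset V → V → Prop) : ℕ → Finset V → Prop
  | 0, T => ∃ S ∈ K, ∃ v, v ∉ S ∧ T = insert v S ∧ bd S v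
  | d + 1, T => θ * Fintype.card V <
      ((univ.filter fun v => v ∉ T ∧ badS K θ bd d (insert v T)).card : ℝ)

variable {V : Type*} [Fintype V] [DecidableEq V]

lemma bad_count0 (K : Set (Finset V)) (θ γ : ℝ) (bd : Finset V → V → Prop) (j : ℕ)
    (hj : 1 ≤ j) (hγ : 0 ≤ γ)
    (hbd : ∀ S ∈ K, S.card + 1 = j →
      ((univ.filter fun v => v ∉ S ∧ bd S v).card : ℝ) ≤ γ * Fintype.card V) :
    ((univ.filter fun T => T.card + 0 = j ∧ badS K θ bd 0 T).card : ℝ) ≤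
      γ * (Fintype.card V : ℝ) ^ j := by
  set n := Fintype.card V
  set Z : Finset (Finset V) := univ.filter fun S => S ∈ K ∧ S.card + 1 = j
  have h1 : (univ.filter fun T => T.card + 0 = j ∧ badS K θ bd 0 T) ⊆
      Z.biUnion (fun S => (univ.filter fun v => v ∉ S ∧ bd S v).image (fun v => insert v S)) := by
    intro T hT
    simp only [mem_filter, mem_univ, true_and] at hT
    obtain ⟨hc, S, hS, v, hv, rfl, hb⟩ := hT
    rw [card_insert_of_notMem hv] at hc
    simp only [mem_biUnion, mem_image, mem_filter, mem_univ, true_and, Z]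
    exact ⟨S, ⟨hS, by omega⟩, v, ⟨hv, hb⟩, rfl⟩
  have h2 : ((Z.biUnion (fun S => (univ.filter fun v => v ∉ S ∧ bd S v).image
      (fun v => insert v S))).card : ℝ) ≤ ∑ S ∈ Z, γ * n := by
    calc _ ≤ ((∑ S ∈ Z, ((univ.filter fun v => v ∉ S ∧ bd S v).image
      (fun v => insert v S)).card : ℕ) : ℝ) := by exact_mod_cast card_biUnion_le
      _ = ∑ S ∈ Z, (((univ.filter fun v => v ∉ S ∧ bd S v).image
      (fun v => insert v S)).card : ℝ) := by push_cast; rfl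
      _ ≤ _ := by
        apply sum_le_sum
        intro S hS
        simp only [mem_filter, mem_univ, true_and, Z] at hS
        refine le_trans ?_ (hbd S hS.1 hS.2)
        exact_mod_cast card_image_le
  have h3 : (Z.card : ℝ) ≤ (n : ℝ) ^ (j - 1) := by
    have : Z ⊆ powersetCard (j - 1) univ := by
      intro S hS
      simp only [mem_filter, mem_univ, true_and, Z] at hS
      simp only [mem_powersetCard, subset_univ, true_and]
      omega
    have := card_le_card this
    rw [card_powersetCard, card_univ] at this
    exact_mod_cast this.trans (Nat.choose_le_pow _ _)
  calc _ ≤ _ := by exact_mod_cast card_le_card h1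
    _ ≤ _ := h2
    _ = Z.card * (γ * n) := by rw [sum_const, nsmul_eq_mul]
    _ ≤ (n : ℝ) ^ (j - 1) * (γ * n) := by gcongr
    _ = γ * ((n : ℝ) ^ (j - 1) * n) := by ring
    _ = _ := by rw [← pow_succ]; congr 2; omega

lemma bad_count_step (K : Set (Finset V)) (θ : ℝ) (bd : Finset V → V → Prop) (j d : ℕ) :
    ((univ.filter fun T => T.card + (d + 1) = j ∧ badS K θ bd (d + 1) T).card : ℝ) *
      (θ * Fintype.card V) ≤
    j * ((univ.filter fun T => T.card + d = j ∧ badS K θ bd d T).card : ℝ) := by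
  set A : Finset (Finset V) := univ.filter fun T => T.card + (d + 1) = j ∧ badS K θ bd (d + 1) T
  set B : Finset (Finset V) := univ.filter fun T => T.card + d = j ∧ badS K θ bd d T
  have key := Finset.card_nsmul_le_card_nsmul (R := ℝ) (s := A) (t := B)
    (fun S T => S ⊆ T) (m := θ * Fintype.card V) (n := (j : ℝ)) ?_ ?_
  · simpa [nsmul_eq_mul, mul_comm] using key
  · intro S hS
    simp only [mem_filter, mem_univ, true_and, A] at hS
    obtain ⟨hc, hb⟩ := hS
    rw [badS] at hb
    refine hb.le.trans ?_
    rw [← card_image_of_injOn (f := fun v => insert v S)]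
    · norm_cast
      apply card_le_card
      intro T hT
      simp only [mem_image, mem_filter, mem_univ, true_and] at hT
      obtain ⟨v, ⟨hv, hb⟩, rfl⟩ := hT
      simp only [bipartiteAbove, mem_filter, mem_univ, true_and, B]
      exact ⟨⟨by rw [card_insert_of_notMem hv]; omega, hb⟩, subset_insert _ _⟩
    · intro v hv w hw h
      simp only [coe_filter, mem_univ, true_and, Set.mem_ofPred_eq] at hv hw
      have h : insert v S = insert w S := h
      have : v ∈ insert w S := by rw [← h]; exact mem_insert_self _ _
      rcases mem_insert.1 this with h | h
      · exact h
      · exact absurd h hv.1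
  · intro T hT
    simp only [mem_filter, mem_univ, true_and, B] at hT
    have : bipartiteBelow (fun S T => S ⊆ T) A T ⊆ T.image (fun v => T.erase v) := by
      intro S hS
      simp only [bipartiteBelow, mem_filter, mem_univ, true_and, A] at hS
      obtain ⟨⟨hc, -⟩, hs⟩ := hS
      have : (T \ S).card = 1 := by rw [card_sdiff_of_subset hs]; omega
      obtain ⟨v, hv⟩ := card_eq_one.1 this
      have hv' : v ∈ T \ S := by rw [hv]; simp
      rw [mem_sdiff] at hv'
      refine mem_image.2 ⟨v, hv'.1, ?_⟩
      symm
      apply eq_of_subset_of_card_le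
      · intro x hx
        exact mem_erase.2 ⟨fun h => hv'.2 (h ▸ hx), hs hx⟩
      · rw [card_erase_of_mem hv'.1]; omega
    have h := (card_le_card this).trans card_image_le
    have : (bipartiteBelow (fun S T => S ⊆ T) A T).card ≤ j := by omega
    exact_mod_cast this

lemma clean (j : ℕ) (hj1 : 1 ≤ j) (hj : j ≤ 4) (K : Set (Finset V)) (δ γ θ : ℝ)
    (hθ0 : 0 < θ) (hθ1 : θ ≤ 1) (hγ0 : 0 ≤ γ) (hγ : 256 * γ < θ ^ 4)
    (hn : 0 < Fintype.card V) (hK : Cx K δ) (bd : Finset V → V → Prop)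
    (hbd : ∀ S ∈ K, S.card + 1 = j →
      ((univ.filter fun v => v ∉ S ∧ bd S v).card : ℝ) ≤ γ * Fintype.card V) :
    ∃ K' : Set (Finset V), K' ⊆ K ∧ Cx K' (δ + 16 * θ) ∧
      ∀ S ∈ K', S.card + 1 = j → ∀ v, v ∉ S → insert v S ∈ K' → ¬ bd S v := by
  have hn' : (0 : ℝ) < Fintype.card V := by exact_mod_cast hn
  set n : ℝ := (Fintype.card V : ℝ)
  have cnt : ∀ d, ((univ.filter fun T => T.card + d = j ∧ badS K θ bd d T).card : ℝ) *
      (θ * n) ^ d ≤ (j : ℝ) ^ d * (γ * n ^ j) := by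
    intro d
    induction d with
    | zero => simpa using bad_count0 K θ γ bd j hj1 hγ0 hbd
    | succ d ih =>
      have := bad_count_step K θ bd j d
      calc _ = (((univ.filter fun T => T.card + (d + 1) = j ∧ badS K θ bd (d + 1) T).card : ℝ) *
          (θ * n)) * (θ * n) ^ d := by ring
        _ ≤ (j * ((univ.filter fun T => T.card + d = j ∧ badS K θ bd d T).card : ℝ)) *
            (θ * n) ^ d := by gcongr
        _ = j * (((univ.filter fun T => T.card + d = j ∧ badS K θ bd d T).card : ℝ) *
            (θ * n) ^ d) := by ring
        _ ≤ j * ((j : ℝ) ^ d * (γ * n ^ j)) := by gcongr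
        _ = _ := by ring
  have h0 : ¬ badS K θ bd j ∅ := by
    intro hb
    have h1 := cnt j
    have h2 : (1 : ℝ) ≤ ((univ.filter fun T => T.card + j = j ∧ badS K θ bd j T).card : ℝ) := by
      have : 0 < (univ.filter fun T => T.card + j = j ∧ badS K θ bd j T).card :=
        card_pos.2 ⟨∅, by simp [hb]⟩
      exact_mod_cast this
    have h3 : (θ * n) ^ j ≤ (j : ℝ) ^ j * (γ * n ^ j) := by
      refine le_trans ?_ h1
      have : 0 ≤ (θ * n) ^ j := by positivity
      nlinarith
    have h4 : (j : ℝ) ^ j ≤ 256 := by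
      have : j ^ j ≤ 256 := by interval_cases j <;> norm_num
      exact_mod_cast this
    have h5 : θ ^ 4 ≤ θ ^ j := pow_le_pow_of_le_one hθ0.le hθ1 hj
    have h6 : 0 < n ^ j := by positivity
    have h7 : (j : ℝ) ^ j * (γ * n ^ j) ≤ 256 * (γ * n ^ j) := by gcongr
    rw [mul_pow] at h3
    have h8 : 256 * (γ * n ^ j) < θ ^ j * n ^ j := by
      rw [← mul_assoc]; exact mul_lt_mul_of_pos_right (hγ.trans_le h5) h6
    linarith
  refine ⟨{S | S ∈ K ∧ ∀ T, T ⊆ S → ∀ d, T.card + d = j → ¬ badS K θ bd d T},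
    fun S h => h.1, ⟨?_, ?_, ?_⟩, ?_⟩
  · refine ⟨hK.1, fun T hT d hd => ?_⟩
    rw [subset_empty] at hT
    subst hT
    simp at hd
    subst hd
    exact h0
  · intro S hS T hT
    exact ⟨hK.2.1 S hS.1 T hT, fun T' hT' => hS.2 T' (hT'.trans hT)⟩
  · intro S hS hc
    have hsub : (univ.filter fun v => insert v S ∉ {S | S ∈ K ∧ ∀ T, T ⊆ S → ∀ d,
        T.card + d = j → ¬ badS K θ bd d T}) ⊆ (univ.filter fun v => insert v S ∉ K) ∪
        S.powerset.biUnion (fun T => univ.filter fun v => v ∉ T ∧ T.card + 1 ≤ j ∧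
          badS K θ bd (j - T.card - 1) (insert v T)) := by
      intro v hv
      simp only [mem_filter, mem_univ, true_and, Set.mem_ofPred_eq] at hv
      simp only [mem_union, mem_filter, mem_univ, true_and, mem_biUnion, mem_powerset]
      by_contra hcon
      push Not at hcon
      apply hv
      refine ⟨hcon.1, fun T hT d hd hb => ?_⟩
      by_cases hvT : v ∈ T
      · have e1 : insert v (T.erase v) = T := insert_erase hvT
        have e2 : T.erase v ⊆ S := by
          intro x hx
          rw [mem_erase] at hx
          rcases mem_insert.1 (hT hx.2) with h | h
          · exact absurd h hx.1
          · exact h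
        have e3 := card_erase_add_one hvT
        refine hcon.2 _ e2 (notMem_erase v T) (by omega) ?_
        rw [e1]
        have : j - (T.erase v).card - 1 = d := by omega
        rw [this]; exact hb
      · refine hS.2 T ?_ d hd hb
        intro x hx
        rcases mem_insert.1 (hT hx) with h | h
        · exact absurd (h ▸ hx) hvT
        · exact h
    have hT : ∀ T ∈ S.powerset, ((univ.filter fun v => v ∉ T ∧ T.card + 1 ≤ j ∧
          badS K θ bd (j - T.card - 1) (insert v T)).card : ℝ) ≤ θ * n := by
      intro T hT
      rw [mem_powerset] at hT
      by_cases hTj : T.card + 1 ≤ j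
      · have := hS.2 T hT (j - T.card - 1 + 1) (by omega)
        rw [badS, not_lt] at this
        simpa [hTj] using this
      · simp [hTj]
        positivity
    have hU : (((S.powerset.biUnion (fun T => univ.filter fun v => v ∉ T ∧ T.card + 1 ≤ j ∧
          badS K θ bd (j - T.card - 1) (insert v T))).card : ℕ) : ℝ) ≤ 16 * (θ * n) := by
      calc _ ≤ ((∑ T ∈ S.powerset, (univ.filter fun v => v ∉ T ∧ T.card + 1 ≤ j ∧
          badS K θ bd (j - T.card - 1) (insert v T)).card : ℕ) : ℝ) := by
            exact_mod_cast card_biUnion_le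
        _ = ∑ T ∈ S.powerset, ((univ.filter fun v => v ∉ T ∧ T.card + 1 ≤ j ∧
          badS K θ bd (j - T.card - 1) (insert v T)).card : ℝ) := by push_cast; rfl
        _ ≤ ∑ T ∈ S.powerset, θ * n := sum_le_sum hT
        _ = (2 ^ S.card : ℕ) * (θ * n) := by rw [sum_const, nsmul_eq_mul, card_powerset]
        _ ≤ 16 * (θ * n) := by
          gcongr
          have : 2 ^ S.card ≤ 2 ^ 4 := Nat.pow_le_pow_right (by norm_num) hc
          exact_mod_cast this
    have := (card_le_card hsub).trans (card_union_le _ _)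
    have h' : ((univ.filter fun v => insert v S ∉ {S | S ∈ K ∧ ∀ T, T ⊆ S → ∀ d,
        T.card + d = j → ¬ badS K θ bd d T}).card : ℝ) ≤
        ((univ.filter fun v => insert v S ∉ K).card : ℝ) +
        ((S.powerset.biUnion (fun T => univ.filter fun v => v ∉ T ∧ T.card + 1 ≤ j ∧
          badS K θ bd (j - T.card - 1) (insert v T))).card : ℝ) := by exact_mod_cast this
    have h'' := hK.2.2 S hS.1 hc
    have hf := (h'.trans (add_le_add h'' hU)).trans
      (le_of_eq (show δ * n + 16 * (θ * n) = (δ + 16 * θ) * n by ring))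
    refine le_trans (le_of_eq ?_) hf
    congr!
  · intro S hS hc v hv hi hb
    refine hi.2 (insert v S) (Subset.refl _) 0 ?_ ?_
    · rw [card_insert_of_notMem hv]; omega
    · exact ⟨S, hS.1, v, hv, rfl, hb⟩

def AdjOK {α : Type*} (K : Set (Finset V)) (k : ℕ) (c : Finset V → Bool) (F : Finset V → α) : Prop :=
  ∀ e ∈ K, ∀ e' ∈ K, e.card = k → e'.card = k → ∀ p, p ⊆ e → p ⊆ e' → p.card + 1 = k →
    c e = c e' → F e = F e'

lemma link {α : Type*} (K : Set (Finset V)) (δ : ℝ) (hK : Cx K δ) (k : ℕ) (hk1 : 1 ≤ k) (hk : k ≤ 3)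
    (c : Finset V → Bool) (F : Finset V → α) (hadj : AdjOK K (k + 2) c F)
    (hδ : δ ≤ 1 / 10) (h1 : 1 ≤ δ * Fintype.card V) (S : Finset V) (hS : S ∈ K)
    (hSc : S.card = k) :
    ∃ (b : Bool) (l : α), ((univ.filter fun v => v ∉ S ∧ ¬ ∃ e ∈ K, e.card = k + 2 ∧
      insert v S ⊆ e ∧ c e = b ∧ F e = l).card : ℝ) ≤ 3 * δ * Fintype.card V := by
  have hn0 : (0 : ℝ) ≤ Fintype.card V := by positivity
  have hx0 : ∃ x, x ∉ S ∧ insert x S ∈ K := by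
    by_contra hcon
    push Not at hcon
    have hsub : (univ : Finset V) ⊆ S ∪ (univ.filter fun v => insert v S ∉ K) := by
      intro x _
      by_cases hx : x ∈ S
      · simp [hx]
      · simp [hcon x hx]
    have h2 := (card_le_card hsub).trans (card_union_le _ _)
    rw [card_univ] at h2
    have h3 := hK.2.2 S hS (by omega)
    have h4 : (Fintype.card V : ℝ) ≤ S.card + ((univ.filter fun v => insert v S ∉ K).card : ℝ) := by
      exact_mod_cast h2
    have h5 : (S.card : ℝ) ≤ 3 := by rw [hSc]; exact_mod_cast hk
    have h6 : δ * Fintype.card V ≤ 1 / 10 * Fintype.card V := by gcongr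
    linarith
  obtain ⟨x0, hx0S, hx0K⟩ := hx0
  set Q := insert x0 S with hQ
  have hQc : Q.card = k + 1 := by rw [hQ, card_insert_of_notMem hx0S, hSc]
  have hlab : ∀ b : Bool, ∃ l, ∀ x, x ∉ Q → insert x Q ∈ K → c (insert x Q) = b →
      F (insert x Q) = l := by
    intro b
    by_cases h : ∃ x, x ∉ Q ∧ insert x Q ∈ K ∧ c (insert x Q) = b
    · obtain ⟨x, hx, hxK, hxc⟩ := h
      refine ⟨F (insert x Q), fun y hy hyK hyc => ?_⟩
      refine hadj _ hyK _ hxK ?_ ?_ Q (subset_insert _ _) (subset_insert _ _) (by omega) (by rw [hyc, hxc])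
      · rw [card_insert_of_notMem hy]; omega
      · rw [card_insert_of_notMem hx]; omega
    · push Not at h
      exact ⟨F ∅, fun x hx hxK hxc => absurd hxc (h x hx hxK)⟩
  choose lab hlab using hlab
  set Cov : Bool → V → Prop := fun b v => ∃ e ∈ K, e.card = k + 2 ∧
      insert v S ⊆ e ∧ c e = b ∧ F e = lab b with hCov
  have hcovQ : ∀ x, x ∉ Q → insert x Q ∈ K → Cov (c (insert x Q)) x := by
    intro x hx hxK
    refine ⟨insert x Q, hxK, by rw [card_insert_of_notMem hx]; omega, ?_, rfl, hlab _ x hx hxK rfl⟩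
    exact insert_subset_insert _ (subset_insert _ _)
  have hQn := hK.2.2 Q hx0K (by omega)
  by_cases hy : ∃ y, y ∉ Q ∧ insert y Q ∈ K ∧ c (insert y Q) = true ∧ ¬ Cov false y
  · obtain ⟨y, hyQ, hyK, hyc, hyn⟩ := hy
    have hyS : y ∉ S := fun h => hyQ (mem_insert_of_mem h)
    have hySK : insert y S ∈ K := hK.2.1 _ hyK _ (insert_subset_insert _ (subset_insert _ _))
    have hySc : (insert y S).card = k + 1 := by rw [card_insert_of_notMem hyS, hSc]
    refine ⟨true, lab true, ?_⟩
    have hsub : (univ.filter fun v => v ∉ S ∧ ¬ Cov true v) ⊆ ({x0} ∪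
        (univ.filter fun v => insert v Q ∉ K)) ∪ (univ.filter fun v => insert v (insert y S) ∉ K) := by
      intro v hv
      simp only [mem_filter, mem_univ, true_and] at hv
      obtain ⟨hvS, hvn⟩ := hv
      simp only [mem_union, mem_singleton, mem_filter, mem_univ, true_and]
      by_contra hcon
      push Not at hcon
      obtain ⟨⟨hvx, hvQ⟩, hvy⟩ := hcon
      have hvQ' : v ∉ Q := by simp [hQ, hvx, hvS]
      have hvf : c (insert v Q) = false := by
        by_contra h
        rw [Bool.not_eq_false] at h
        exact hvn (h ▸ hcovQ v hvQ' hvQ)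
      have hvny : v ≠ y := by
        rintro rfl
        rw [hyc] at hvf; exact absurd hvf (by simp)
      have hvyS : v ∉ insert y S := by simp [hvny, hvS]
      have hec : (insert v (insert y S)).card = k + 2 := by
        rw [card_insert_of_notMem hvyS]; omega
      by_cases hce : c (insert v (insert y S)) = true
      · apply hvn
        refine ⟨_, hvy, hec, insert_subset_insert _ (subset_insert _ _), hce, ?_⟩
        rw [← hlab true y hyQ hyK hyc]
        refine hadj _ hvy _ hyK hec ?_ (insert y S) (subset_insert _ _)
          (insert_subset_insert _ (subset_insert _ _)) (by omega) (by rw [hce, hyc])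
        rw [card_insert_of_notMem hyQ]; omega
      · rw [Bool.not_eq_true] at hce
        apply hyn
        refine ⟨_, hvy, hec, subset_insert _ _, hce, ?_⟩
        rw [← hlab false v hvQ' hvQ hvf]
        refine hadj _ hvy _ hvQ hec ?_ (insert v S) (insert_subset_insert _ (subset_insert _ _))
          (insert_subset_insert _ (subset_insert _ _)) ?_ (by rw [hce, hvf])
        · rw [card_insert_of_notMem hvQ']; omega
        · rw [card_insert_of_notMem hvS]; omega
    have h2 := (card_le_card hsub).trans ((card_union_le _ _).trans
      (Nat.add_le_add_right (card_union_le _ _) _))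
    rw [card_singleton] at h2
    have h3 := hK.2.2 _ hySK (by omega)
    have h4 : ((univ.filter fun v => v ∉ S ∧ ¬ Cov true v).card : ℝ) ≤
      1 + ((univ.filter fun v => insert v Q ∉ K).card : ℝ) +
        ((univ.filter fun v => insert v (insert y S) ∉ K).card : ℝ) := by exact_mod_cast h2
    linarith
  · push Not at hy
    refine ⟨false, lab false, ?_⟩
    have hsub : (univ.filter fun v => v ∉ S ∧ ¬ Cov false v) ⊆ ({x0} ∪
        (univ.filter fun v => insert v Q ∉ K)) := by
      intro v hv
      simp only [mem_filter, mem_univ, true_and] at hv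
      obtain ⟨hvS, hvn⟩ := hv
      simp only [mem_union, mem_singleton, mem_filter, mem_univ, true_and]
      by_contra hcon
      push Not at hcon
      obtain ⟨hvx, hvQ⟩ := hcon
      have hvQ' : v ∉ Q := by simp [hQ, hvx, hvS]
      by_cases hce : c (insert v Q) = true
      · exact hvn (hy v hvQ' hvQ hce)
      · rw [Bool.not_eq_true] at hce
        exact hvn (hce ▸ hcovQ v hvQ' hvQ)
    have h2 := (card_le_card hsub).trans (card_union_le _ _)
    rw [card_singleton] at h2
    have h4 : ((univ.filter fun v => v ∉ S ∧ ¬ Cov false v).card : ℝ) ≤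
      1 + ((univ.filter fun v => insert v Q ∉ K).card : ℝ) := by exact_mod_cast h2
    linarith

lemma blueprint {α : Type*} (K : Set (Finset V)) (δ θ θ' : ℝ) (hK : Cx K δ) (k : ℕ)
    (hk1 : 1 ≤ k) (hk : k ≤ 3)
    (c : Finset V → Bool) (F : Finset V → α) (hadj : AdjOK K (k + 2) c F)
    (hδ : δ ≤ 1 / 10) (h1 : 1 ≤ δ * Fintype.card V)
    (hδ0 : 0 < δ) (hθ0 : 0 < θ) (hθ1 : θ ≤ 1) (hθ0' : 0 < θ') (hθ1' : θ' ≤ 1)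
    (hc1 : 256 * (3 * δ) < θ ^ 4) (hc2 : 256 * (4 * (δ + 16 * θ)) < θ' ^ 4) :
    ∃ (K' : Set (Finset V)) (c' : Finset V → Bool) (F' : Finset V → α),
      K' ⊆ K ∧ Cx K' (δ + 16 * θ + 16 * θ') ∧ AdjOK K' k c' F' ∧
      ∀ S ∈ K', ∀ e ∈ K', S.card = k → e.card = k + 2 → S ⊆ e → c e = c' S → F e = F' S := by
  have hn : 0 < Fintype.card V := by
    by_contra h
    have : Fintype.card V = 0 := by omega
    rw [this] at h1; norm_num at h1
  have hl : ∀ S : Finset V, ∃ bl : Bool × α, S ∈ K → S.card = k →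
      ((univ.filter fun v => v ∉ S ∧ ¬ ∃ e ∈ K, e.card = k + 2 ∧
      insert v S ⊆ e ∧ c e = bl.1 ∧ F e = bl.2).card : ℝ) ≤ 3 * δ * Fintype.card V := by
    intro S
    by_cases h : S ∈ K ∧ S.card = k
    · obtain ⟨b, l, hh⟩ := link K δ hK k hk1 hk c F hadj hδ h1 S h.1 h.2
      exact ⟨(b, l), fun _ _ => hh⟩
    · exact ⟨(true, F ∅), fun h1 h2 => absurd ⟨h1, h2⟩ h⟩
  choose bl hbl using hl
  obtain ⟨K1, hK1K, hK1, hK1b⟩ := clean (k + 1) (by omega) (by omega) K δ (3 * δ) θ hθ0 hθ1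
    (by positivity) hc1 hn hK (fun S v => ¬ ∃ e ∈ K, e.card = k + 2 ∧
      insert v S ⊆ e ∧ c e = (bl S).1 ∧ F e = (bl S).2)
    (fun S hS hSc => le_trans (le_of_eq (by congr!)) (hbl S hS (by omega)))
  have hcov : ∀ S ∈ K1, S.card = k → ∀ p ∈ K1, p.card = k + 1 → S ⊆ p →
      ∃ e ∈ K, e.card = k + 2 ∧ p ⊆ e ∧ c e = (bl S).1 ∧ F e = (bl S).2 := by
    intro S hS hSc p hp hpc hSp
    have : (p \ S).card = 1 := by rw [card_sdiff_of_subset hSp]; omega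
    obtain ⟨v, hv⟩ := card_eq_one.1 this
    have hv' : v ∈ p \ S := by rw [hv]; simp
    rw [mem_sdiff] at hv'
    have hpe : insert v S = p := by
      apply eq_of_subset_of_card_le (insert_subset hv'.1 hSp)
      rw [card_insert_of_notMem hv'.2]; omega
    have := hK1b S hS (by omega) v hv'.2 (by rw [hpe]; exact hp)
    rw [not_not, hpe] at this
    exact this
  set δ1 := δ + 16 * θ with hδ1
  set n : ℝ := (Fintype.card V : ℝ) with hnn
  have hδ1n : 0 ≤ δ1 * n := by positivity
  set few : Bool → Finset V → Prop := fun b q =>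
    ((univ.filter fun x => x ∉ q ∧ insert x q ∈ K1 ∧ (bl (insert x q)).1 = b).card : ℝ) ≤ 2 * (δ1 * n)
    with hfew
  obtain ⟨K2, hK2K, hK2, hK2b⟩ := clean k hk1 (by omega) K1 δ1 (4 * δ1) θ' hθ0' hθ1'
    (by positivity) hc2 hn hK1 (fun q x => insert x q ∈ K1 ∧ few (bl (insert x q)).1 q) (by
      intro q hq hqc
      have hb : ∀ b, ((univ.filter fun x => x ∉ q ∧ insert x q ∈ K1 ∧ (bl (insert x q)).1 = b ∧
          few b q).card : ℝ) ≤ 2 * (δ1 * n) := by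
        intro b
        by_cases h : few b q
        · refine le_trans ?_ (show ((univ.filter fun x => x ∉ q ∧ insert x q ∈ K1 ∧
            (bl (insert x q)).1 = b).card : ℝ) ≤ 2 * (δ1 * n) from h)
          norm_cast
          apply card_le_card
          intro x hx
          simp only [mem_filter, mem_univ, true_and] at hx ⊢
          exact ⟨hx.1, hx.2.1, hx.2.2.1⟩
        · simp [h]; exact hδ1n
      have hsub : (univ.filter fun v => v ∉ q ∧ insert v q ∈ K1 ∧ few (bl (insert v q)).1 q) ⊆
          (univ.filter fun x => x ∉ q ∧ insert x q ∈ K1 ∧ (bl (insert x q)).1 = true ∧ few true q) ∪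
          (univ.filter fun x => x ∉ q ∧ insert x q ∈ K1 ∧ (bl (insert x q)).1 = false ∧ few false q) := by
        intro v hv
        simp only [mem_filter, mem_univ, true_and, mem_union] at hv ⊢
        obtain ⟨h1, h2, h3⟩ := hv
        cases hbv : (bl (insert v q)).1
        · right; exact ⟨h1, h2, rfl, hbv ▸ h3⟩
        · left; exact ⟨h1, h2, rfl, hbv ▸ h3⟩
      have h2 := (card_le_card hsub).trans (card_union_le _ _)
      have h3 := hb true
      have h4 := hb false
      have h5 : ((univ.filter fun v => v ∉ q ∧ insert v q ∈ K1 ∧ few (bl (insert v q)).1 q).card : ℝ)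
        ≤ ((univ.filter fun x => x ∉ q ∧ insert x q ∈ K1 ∧ (bl (insert x q)).1 = true ∧ few true q).card : ℝ)
        + ((univ.filter fun x => x ∉ q ∧ insert x q ∈ K1 ∧ (bl (insert x q)).1 = false ∧ few false q).card : ℝ) := by
        exact_mod_cast h2
      have h6 : ((univ.filter fun v => v ∉ q ∧ insert v q ∈ K1 ∧ few (bl (insert v q)).1 q).card : ℝ)
        ≤ 4 * δ1 * Fintype.card V := by linarith
      exact le_trans (le_of_eq (by congr!)) h6)
  refine ⟨K2, fun S => (bl S).1, fun S => (bl S).2, hK2K.trans hK1K, hK2, ?_, ?_⟩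
  · intro S hS S' hS' hSc hSc' q hqS hqS' hqc hcc
    have hqK2 : q ∈ K2 := hK2.2.1 S hS q hqS
    have hx : ∀ S, S.card = k → q ⊆ S → ∃ x, x ∉ q ∧ S = insert x q := by
      intro S hSc hqS
      have : (S \ q).card = 1 := by rw [card_sdiff_of_subset hqS]; omega
      obtain ⟨v, hv⟩ := card_eq_one.1 this
      have hv' : v ∈ S \ q := by rw [hv]; simp
      rw [mem_sdiff] at hv'
      refine ⟨v, hv'.2, ?_⟩
      symm
      apply eq_of_subset_of_card_le (insert_subset hv'.1 hqS)
      rw [card_insert_of_notMem hv'.2]; omega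
    obtain ⟨x, hx1, rfl⟩ := hx S hSc hqS
    obtain ⟨x', hx1', rfl⟩ := hx S' hSc' hqS'
    have hnf : ¬ few (bl (insert x q)).1 q := by
      intro hf
      exact hK2b q hqK2 hqc x hx1 hS ⟨hK2K hS, hf⟩
    have hxn := hK1.2.2 _ (hK2K hS) (by omega)
    have hxn' := hK1.2.2 _ (hK2K hS') (by omega)
    have hy : ∃ y, y ∉ q ∧ insert y q ∈ K1 ∧ (bl (insert y q)).1 = (bl (insert x q)).1 ∧
        insert y (insert x q) ∈ K1 ∧ insert y (insert x' q) ∈ K1 := by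
      by_contra hcon
      push Not at hcon
      apply hnf
      have hsub : (univ.filter fun y => y ∉ q ∧ insert y q ∈ K1 ∧
          (bl (insert y q)).1 = (bl (insert x q)).1) ⊆
          (univ.filter fun y => insert y (insert x q) ∉ K1) ∪
          (univ.filter fun y => insert y (insert x' q) ∉ K1) := by
        intro y hy
        simp only [mem_filter, mem_univ, true_and, mem_union] at hy ⊢
        by_cases h : insert y (insert x q) ∈ K1
        · right; exact hcon y hy.1 hy.2.1 hy.2.2 h
        · left; exact h
      have h2 := (card_le_card hsub).trans (card_union_le _ _)
      have h5 : ((univ.filter fun y => y ∉ q ∧ insert y q ∈ K1 ∧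
          (bl (insert y q)).1 = (bl (insert x q)).1).card : ℝ) ≤
          ((univ.filter fun y => insert y (insert x q) ∉ K1).card : ℝ) +
          ((univ.filter fun y => insert y (insert x' q) ∉ K1).card : ℝ) := by exact_mod_cast h2
      show ((univ.filter fun y => y ∉ q ∧ insert y q ∈ K1 ∧
          (bl (insert y q)).1 = (bl (insert x q)).1).card : ℝ) ≤ _
      linarith
    obtain ⟨y, hyq, hyK, hyc, hyx, hyx'⟩ := hy
    have key : ∀ z, z ∉ q → insert z q ∈ K1 → insert y (insert z q) ∈ K1 →
        (bl (insert y q)).1 = (bl (insert z q)).1 → (bl (insert z q)).2 = (bl (insert y q)).2 := by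
      intro z hz hzK hyz hzc
      by_cases hzy : z = y
      · rw [hzy]
      have hyz' : y ∉ insert z q := by
        rw [mem_insert, not_or]; exact ⟨fun h => hzy h.symm, hyq⟩
      have hzq : (insert z q).card = k := by rw [card_insert_of_notMem hz]; exact hqc
      have hyq' : (insert y q).card = k := by rw [card_insert_of_notMem hyq]; exact hqc
      have hpc : (insert y (insert z q)).card = k + 1 := by
        rw [card_insert_of_notMem hyz', hzq]
      obtain ⟨e, he, hec, hpe, hcee, hFe⟩ := hcov _ hzK hzq _ hyz hpc (subset_insert _ _)
      obtain ⟨e', he', hec', hpe', hcee', hFe'⟩ := hcov _ hyK hyq' _ hyz hpc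
        (insert_subset_insert _ (subset_insert _ _))
      rw [← hFe, ← hFe']
      exact hadj e he e' he' hec hec' _ hpe hpe' (by omega) (by rw [hcee, hcee', hzc])
    have a1 := key x hx1 (hK2K hS) hyx hyc
    have a2 := key x' hx1' (hK2K hS') hyx' (by rw [hyc]; exact hcc)
    show (bl (insert x q)).2 = (bl (insert x' q)).2
    rw [a1, a2]
  · intro S hS e he hSc hec hSe hce
    obtain ⟨p, hSp, hpe, hpc⟩ := exists_subsuperset_card_eq hSe (n := k + 1) (by omega) (by omega)
    have hpK : p ∈ K1 := hK1.2.1 e (hK2K he) p hpe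
    obtain ⟨e', he', hec', hpe', hcee', hFe'⟩ := hcov S (hK2K hS) hSc p hpK hpc hSp
    show F e = (bl S).2
    rw [← hFe']
    exact hadj e (hK1K (hK2K he)) e' he' hec hec' p hpe hpe' (by omega) (by rw [hce, hcee'])

lemma exists_erase_swap {T T' : Finset V} {k : ℕ} (hT : T.card = k) (hT' : T'.card = k)
    (hne : T ≠ T') : (∃ a ∈ T, a ∉ T') ∧ ∃ b ∈ T', b ∉ T := by
  constructor
  · by_contra h
    push Not at h
    exact hne (eq_of_subset_of_card_le h (by omega))
  · by_contra h
    push Not at h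
    exact hne (eq_of_subset_of_card_le h (by omega)).symm

lemma swap_facts {T : Finset V} {a x : V} (ha : a ∈ T) (hx : x ∉ T) :
    (insert x (T.erase a)).card = T.card ∧ T ∩ insert x (T.erase a) = T.erase a := by
  have hx' : x ∉ T.erase a := fun h => hx (mem_of_mem_erase h)
  refine ⟨by rw [card_insert_of_notMem hx', card_erase_add_one ha], ?_⟩
  ext y
  simp only [mem_inter, mem_insert, mem_erase]
  constructor
  · rintro ⟨h1, rfl | h2⟩
    · exact absurd h1 hx
    · exact h2
  · rintro h
    exact ⟨h.2, Or.inr h⟩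

lemma johnson (X : Finset V) (k : ℕ) (P : Finset V → Prop)
    (hP : ∀ S S', S ⊆ X → S' ⊆ X → S.card = k → S'.card = k → (S ∩ S').card + 1 = k → P S → P S')
    (T' : Finset V) (hT' : T' ⊆ X) (hTc' : T'.card = k) :
    ∀ (d : ℕ) (T : Finset V), (T \ T').card = d → T ⊆ X → T.card = k → P T → P T' := by
  intro d
  induction d with
  | zero =>
    intro T hd hT hTc h
    rw [card_eq_zero, sdiff_eq_empty_iff_subset] at hd
    rw [← eq_of_subset_of_card_le hd (by omega)]
    exact h
  | succ d ih =>
    intro T hd hT hTc h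
    by_cases hne : T = T'
    · rw [← hne]; exact h
    obtain ⟨⟨a, ha, ha'⟩, b, hb, hb'⟩ := exists_erase_swap hTc hTc' hne
    obtain ⟨f1, f2⟩ := swap_facts ha hb'
    have hsub : insert b (T.erase a) ⊆ X :=
      insert_subset (hT' hb) ((erase_subset _ _).trans hT)
    refine ih (insert b (T.erase a)) ?_ hsub (f1.trans hTc)
      (hP T _ hT hsub hTc (f1.trans hTc) ?_ h)
    · have : insert b (T.erase a) \ T' = (T \ T').erase a := by
        ext y
        simp only [mem_sdiff, mem_insert, mem_erase]
        constructor
        · rintro ⟨rfl | h, h2⟩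
          · exact absurd hb h2
          · exact ⟨h.1, h.2, h2⟩
        · rintro ⟨h1, h2, h3⟩
          exact ⟨Or.inr ⟨h1, h2⟩, h3⟩
      rw [this, card_erase_of_mem (mem_sdiff.2 ⟨ha, ha'⟩)]; omega
    · rw [f2, card_erase_add_one ha, hTc]

lemma conn (K : Set (Finset V)) (δ : ℝ) (hK : Cx K δ) (W : Finset V)
    (hW : 2 * δ * Fintype.card V + 10 < W.card) (P : Finset V → Prop)
    (hP : ∀ e ∈ K, ∀ e' ∈ K, e ⊆ W → e' ⊆ W → e.card = 5 → e'.card = 5 → (e ∩ e').card = 4 →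
      P e → P e') :
    ∀ (d : ℕ) (f f' : Finset V), (f \ f').card ≤ d → f ∈ K → f' ∈ K → f ⊆ W → f' ⊆ W →
      f.card = 5 → f'.card = 5 → P f → P f' := by
  intro d
  induction d with
  | zero =>
    intro f f' hd _ _ _ _ hf hf' h
    rw [Nat.le_zero, card_eq_zero, sdiff_eq_empty_iff_subset] at hd
    rw [← eq_of_subset_of_card_le hd (by omega)]
    exact h
  | succ d ih =>
    intro f f' hd hfK hfK' hfW hfW' hf hf' h
    by_cases hne : f = f'
    · rw [← hne]; exact h
    obtain ⟨⟨a, ha, ha'⟩, b, hb, hb'⟩ := exists_erase_swap hf hf' hne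
    have hfa : f.erase a ∈ K := hK.2.1 f hfK _ (erase_subset _ _)
    have hfb : f'.erase b ∈ K := hK.2.1 f' hfK' _ (erase_subset _ _)
    have hx : ∃ x ∈ W, x ∉ f ∧ x ∉ f' ∧ insert x (f.erase a) ∈ K ∧ insert x (f'.erase b) ∈ K := by
      by_contra hcon
      push Not at hcon
      have hsub : W ⊆ (f ∪ f') ∪ ((univ.filter fun v => insert v (f.erase a) ∉ K) ∪
          (univ.filter fun v => insert v (f'.erase b) ∉ K)) := by
        intro x hx
        simp only [mem_union, mem_filter, mem_univ, true_and]
        by_contra h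
        push Not at h
        exact hcon x hx h.1.1 h.1.2 h.2.1 h.2.2
      have h1 := (card_le_card hsub).trans ((card_union_le _ _).trans
        (Nat.add_le_add (card_union_le _ _) (card_union_le _ _)))
      have h2 := hK.2.2 _ hfa (by rw [card_erase_of_mem ha]; omega)
      have h3 := hK.2.2 _ hfb (by rw [card_erase_of_mem hb]; omega)
      rw [hf, hf'] at h1
      have h4 : (W.card : ℝ) ≤ 5 + 5 + (((univ.filter fun v => insert v (f.erase a) ∉ K).card : ℝ) +
        ((univ.filter fun v => insert v (f'.erase b) ∉ K).card : ℝ)) := by exact_mod_cast h1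
      linarith
    obtain ⟨x, hxW, hxf, hxf', hxK, hxK'⟩ := hx
    obtain ⟨f1, f2⟩ := swap_facts ha hxf
    obtain ⟨g1, g2⟩ := swap_facts hb hxf'
    have s1 : insert x (f.erase a) ⊆ W := insert_subset hxW ((erase_subset _ _).trans hfW)
    have s2 : insert x (f'.erase b) ⊆ W := insert_subset hxW ((erase_subset _ _).trans hfW')
    have p1 := hP f hfK _ hxK hfW s1 hf (f1.trans hf)
      (by rw [f2, card_erase_of_mem ha]; omega) h
    have p2 := ih _ _ ?_ hxK hxK' s1 s2 (f1.trans hf) (g1.trans hf') p1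
    · exact hP _ hxK' f' hfK' s2 hfW' (g1.trans hf') hf'
        (by rw [inter_comm, g2, card_erase_of_mem hb]; omega) p2
    · have : insert x (f.erase a) \ insert x (f'.erase b) ⊆ (f \ f').erase a := by
        intro y hy
        simp only [mem_sdiff, mem_insert, mem_erase, not_or, not_and] at hy ⊢
        obtain ⟨h1, h2, h3⟩ := hy
        rcases h1 with h1 | h1
        · exact absurd h1 h2
        · refine ⟨h1.1, h1.2, h3 ?_⟩
          rintro rfl
          exact hb' h1.2
      have h1 := card_le_card this
      rw [card_erase_of_mem (mem_sdiff.2 ⟨ha, ha'⟩)] at h1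
      omega

lemma greedy (K : Set (Finset V)) (δ : ℝ) (hK : Cx K δ) (W : Finset V)
    (hW : δ * Fintype.card V + 5 < W.card) :
    ∀ i ≤ 5, ∃ e ∈ K, e ⊆ W ∧ e.card = i := by
  intro i
  induction i with
  | zero => exact fun _ => ⟨∅, hK.1, empty_subset _, rfl⟩
  | succ i ih =>
    intro hi
    obtain ⟨S, hS, hSW, hSc⟩ := ih (by omega)
    have hx : ∃ x ∈ W, x ∉ S ∧ insert x S ∈ K := by
      by_contra hcon
      push Not at hcon
      have hsub : W ⊆ S ∪ (univ.filter fun v => insert v S ∉ K) := by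
        intro x hx
        simp only [mem_union, mem_filter, mem_univ, true_and]
        by_contra h
        push Not at h
        exact hcon x hx h.1 h.2
      have h1 := (card_le_card hsub).trans (card_union_le _ _)
      have h2 := hK.2.2 _ hS (by omega)
      have h4 : (W.card : ℝ) ≤ S.card + ((univ.filter fun v => insert v S ∉ K).card : ℝ) := by
        exact_mod_cast h1
      have h5 : (S.card : ℝ) ≤ 5 := by exact_mod_cast (by omega : S.card ≤ 5)
      linarith
    obtain ⟨x, hxW, hxS, hxK⟩ := hx
    exact ⟨insert x S, hxK, insert_subset hxW hSW, by rw [card_insert_of_notMem hxS, hSc]⟩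

lemma maxmatch (G : Set (Finset V)) (W : Finset V) :
    ∃ M : Finset (Finset V), (∀ e ∈ M, e ∈ G ∧ e ⊆ W) ∧ IsMatching M ∧
      ∀ e ∈ G, e ⊆ W \ M.biUnion id → e = ∅ := by
  obtain ⟨M, hM, hmax⟩ := exists_max_image
    ((univ : Finset (Finset (Finset V))).filter fun M => (∀ e ∈ M, e ∈ G ∧ e ⊆ W) ∧ IsMatching M)
    card ⟨∅, mem_filter.2 ⟨mem_univ _, by simp, by simp [IsMatching]⟩⟩
  simp only [mem_filter, mem_univ, true_and] at hM hmax
  refine ⟨M, hM.1, hM.2, fun e he heW => ?_⟩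
  have hd : ∀ f ∈ M, Disjoint e f := by
    intro f hf
    rw [disjoint_left]
    intro x hx hxf
    have := heW hx
    rw [mem_sdiff, mem_biUnion] at this
    exact this.2 ⟨f, hf, hxf⟩
  by_cases heM : e ∈ M
  · have := hd e heM
    rwa [disjoint_self] at this
  · exfalso
    have := hmax (insert e M) ⟨?_, ?_⟩
    · rw [card_insert_of_notMem heM] at this; omega
    · intro f hf
      rcases mem_insert.1 hf with rfl | hf
      · exact ⟨he, heW.trans sdiff_subset⟩
      · exact hM.1 f hf
    · intro f hf g hg hne
      rcases mem_insert.1 hf with rfl | hf1 <;> rcases mem_insert.1 hg with rfl | hg1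
      · exact absurd rfl hne
      · exact hd g hg1
      · exact (hd f hf1).symm
      · exact hM.2 f hf1 g hg1 hne

lemma tc_refl (k : ℕ) (Hc : Finset (Finset V)) (f : Finset V) (hf : f ∈ Hc) : TightConn k Hc f f :=
  ⟨0, fun _ => f, rfl, rfl, fun _ _ => hf, fun i hi => absurd hi (by omega)⟩

lemma tc_cons (k : ℕ) (Hc : Finset (Finset V)) (g f f' : Finset V) (hg : g ∈ Hc)
    (hgf : (g ∩ f).card = k - 1) (h : TightConn k Hc f f') : TightConn k Hc g f' := by
  obtain ⟨t, e, h0, ht, he, hs⟩ := h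
  refine ⟨t + 1, fun i => if i = 0 then g else e (i - 1), by simp, by simpa using ht, ?_, ?_⟩
  · intro i hi
    by_cases h : i = 0
    · simp [h, hg]
    · simp only [h, if_false]
      exact he _ (by omega)
  · intro i hi
    by_cases h : i = 0
    · simp [h, h0, hgf]
    · obtain ⟨j, rfl⟩ := Nat.exists_eq_succ_of_ne_zero h
      simpa using hs j (by omega)


lemma four_disj (A B C D : Finset V) (h1 : Disjoint A B) (h2 : Disjoint A C) (h3 : Disjoint A D)
    (h4 : Disjoint B C) (h5 : Disjoint B D) (h6 : Disjoint C D) (X : Fin 4 → Finset V)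
    (e0 : X 0 = A) (e1 : X 1 = B) (e2 : X 2 = C) (e3 : X 3 = D) :
    ∀ i j, i ≠ j → Disjoint (X i) (X j) := by
  have key : ∀ i j : Fin 4, i < j → Disjoint (X i) (X j) := by
    subst e0 e1 e2 e3
    simp only [Fin.forall_fin_succ, Fin.forall_fin_zero]
    simp [*]
  intro i j hij
  rcases lt_or_gt_of_ne hij with h | h
  · exact key i j h
  · exact (key j i h).symm

lemma assemble (H : Finset (Finset V)) (cH : Finset V → Bool) (L : ℝ)
    (M1 M2 M3 M4 : Finset (Finset V)) (b1 b2 b3 b4 : Bool)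
    (h1 : IsTCMatching 5 (H.filter (fun f => cH f = b1)) M1)
    (h2 : IsTCMatching 5 (H.filter (fun f => cH f = b2)) M2)
    (h3 : IsTCMatching 5 (H.filter (fun f => cH f = b3)) M3)
    (h4 : IsTCMatching 5 (H.filter (fun f => cH f = b4)) M4)
    (d12 : Disjoint (M1.biUnion id) (M2.biUnion id))
    (d13 : Disjoint (M1.biUnion id) (M3.biUnion id))
    (d14 : Disjoint (M1.biUnion id) (M4.biUnion id))
    (d23 : Disjoint (M2.biUnion id) (M3.biUnion id))
    (d24 : Disjoint (M2.biUnion id) (M4.biUnion id))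
    (d34 : Disjoint (M3.biUnion id) (M4.biUnion id))
    (R : Finset V) (hR : (R.card : ℝ) ≤ L)
    (hcov : ∀ x, x ∉ M1.biUnion id → x ∉ M2.biUnion id → x ∉ M3.biUnion id → x ∉ M4.biUnion id →
      x ∈ R) :
    ∃ (M : Fin 4 → Finset (Finset V)) (b : Fin 4 → Bool),
      (∀ i, IsTCMatching 5 (H.filter (fun f => cH f = b i)) (M i)) ∧
      (∀ i j, i ≠ j → Disjoint ((M i).biUnion id) ((M j).biUnion id)) ∧
      (Fintype.card V : ℝ) - L ≤
        (((Finset.univ : Finset (Fin 4)).biUnion (fun i => (M i).biUnion id)).card : ℝ) := by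
  obtain ⟨M, e0, e1, e2, e3⟩ : ∃ M : Fin 4 → Finset (Finset V), M 0 = M1 ∧ M 1 = M2 ∧ M 2 = M3 ∧
    M 3 = M4 := ⟨![M1, M2, M3, M4], rfl, rfl, rfl, rfl⟩
  obtain ⟨b, f0, f1, f2, f3⟩ : ∃ b : Fin 4 → Bool, b 0 = b1 ∧ b 1 = b2 ∧ b 2 = b3 ∧
    b 3 = b4 := ⟨![b1, b2, b3, b4], rfl, rfl, rfl, rfl⟩
  subst e0 e1 e2 e3 f0 f1 f2 f3
  refine ⟨M, b, ?_, four_disj _ _ _ _ d12 d13 d14 d23 d24 d34 (fun i => (M i).biUnion id)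
    rfl rfl rfl rfl, ?_⟩
  · rw [Fin.forall_fin_succ, Fin.forall_fin_succ, Fin.forall_fin_succ, Fin.forall_fin_succ]
    exact ⟨h1, h2, h3, h4, fun i => i.elim0⟩
  · set U := (Finset.univ : Finset (Fin 4)).biUnion (fun i => (M i).biUnion id) with hU
    have hsub : (univ : Finset V) ⊆ U ∪ R := by
      intro x _
      by_contra hx
      rw [mem_union, not_or] at hx
      obtain ⟨hxU, hxW⟩ := hx
      have key : ∀ i, x ∉ (M i).biUnion id := by
        intro i hi
        exact hxU (mem_biUnion.2 ⟨i, mem_univ _, hi⟩)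
      exact hxW (hcov x (key 0) (key 1) (key 2) (key 3))
    have h2 := (card_le_card hsub).trans (card_union_le _ _)
    rw [card_univ] at h2
    have h3 : (Fintype.card V : ℝ) ≤ U.card + (R.card : ℝ) := by
      exact_mod_cast h2
    linarith


lemma b_ne (a b : Bool) (h : ¬ a = b) : b = !a := by cases a <;> cases b <;> simp at h ⊢
lemma b_tri (a b c : Bool) (h : b = !a) (h' : ¬ c = a) : c = b := by
  cases a <;> cases b <;> cases c <;> simp at h h' ⊢

set_option maxHeartbeats 1000000 in
lemma core {α : Type*} (H : Finset (Finset V)) (cH : Finset V → Bool) (K : Set (Finset V))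
    (δ L : ℝ) (hδ : 0 ≤ δ) (hK : Cx K δ) (F5 F3 F1 : Finset V → α) (c3 c1 : Finset V → Bool)
    (hF5 : ∀ e ∈ K, ∀ e' ∈ K, e.card = 5 → e'.card = 5 → cH e = cH e' → F5 e = F5 e' →
      TightConn 5 (H.filter (fun f => cH f = cH e)) e e')
    (hKH : ∀ e ∈ K, e.card = 5 → e ∈ H)
    (h5 : AdjOK K 5 cH F5) (h3 : AdjOK K 3 c3 F3) (h1 : AdjOK K 1 c1 F1)
    (h53 : ∀ S ∈ K, ∀ e ∈ K, S.card = 3 → e.card = 5 → S ⊆ e → cH e = c3 S → F5 e = F3 S)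
    (h31 : ∀ S ∈ K, ∀ e ∈ K, S.card = 1 → e.card = 3 → S ⊆ e → c3 e = c1 S → F3 e = F1 S)
    (hL : 2 * δ * Fintype.card V + 10 ≤ L) :
    ∃ (M : Fin 4 → Finset (Finset V)) (b : Fin 4 → Bool),
      (∀ i, IsTCMatching 5 (H.filter (fun f => cH f = b i)) (M i)) ∧
      (∀ i j, i ≠ j → Disjoint ((M i).biUnion id) ((M j).biUnion id)) ∧
      (Fintype.card V : ℝ) - L ≤
        (((Finset.univ : Finset (Fin 4)).biUnion (fun i => (M i).biUnion id)).card : ℝ) := by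
  have hn0 : 0 ≤ δ * Fintype.card V := by positivity
  have hLab : ∀ b, ∃ l, ∀ v, {v} ∈ K → c1 {v} = b → F1 {v} = l := by
    intro b
    by_cases h : ∃ v, {v} ∈ K ∧ c1 {v} = b
    · obtain ⟨v, hv, hb⟩ := h
      exact ⟨F1 {v}, fun w hw hwb => h1 _ hw _ hv (card_singleton _) (card_singleton _) ∅
        (empty_subset _) (empty_subset _) rfl (by rw [hb, hwb])⟩
    · push Not at h
      exact ⟨F1 ∅, fun v hv hb => absurd hb (h v hv)⟩
  choose Lab hLab using hLab
  obtain ⟨M0, hM0, hM0m, hM0x⟩ := maxmatch {e | e ∈ K ∧ e.card = 5 ∧ F5 e = Lab (cH e)} univ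
  set W1 : Finset V := univ \ M0.biUnion id with hW1
  have hno : ∀ e ∈ K, e.card = 5 → e ⊆ W1 → F5 e ≠ Lab (cH e) := by
    intro e he hec heW hF
    have := hM0x e ⟨he, hec, hF⟩ heW
    rw [this] at hec
    simp at hec
  suffices hmain : ∃ (M3 M4 : Finset (Finset V)) (b3 b4 : Bool), (∀ e ∈ M3, e ⊆ W1) ∧
      (∀ e ∈ M4, e ⊆ W1 \ M3.biUnion id) ∧
      IsTCMatching 5 (H.filter (fun f => cH f = b3)) M3 ∧
      IsTCMatching 5 (H.filter (fun f => cH f = b4)) M4 ∧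
      ((((W1 \ M3.biUnion id) \ M4.biUnion id).card : ℕ) : ℝ) ≤ L by
    obtain ⟨M3, M4, b3, b4, hM3, hM4, hT3, hT4, hcard⟩ := hmain
    have hTb : ∀ b, IsTCMatching 5 (H.filter (fun f => cH f = b)) (M0.filter fun e => cH e = b) := by
      intro b
      refine ⟨?_, ?_, ?_⟩
      · intro e he
        rw [mem_filter] at he ⊢
        have := (hM0 e he.1).1
        exact ⟨hKH e this.1 this.2.1, he.2⟩
      · intro e he f hf
        exact hM0m e (mem_filter.1 he).1 f (mem_filter.1 hf).1
      · intro e he f hf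
        rw [mem_filter] at he hf
        have h1 := (hM0 e he.1).1
        have h2 := (hM0 f hf.1).1
        have := hF5 e h1.1 f h2.1 h1.2.1 h2.2.1 (he.2.trans hf.2.symm)
          (by rw [h1.2.2, h2.2.2, he.2, hf.2])
        rwa [he.2] at this
    have d0 : ∀ b, (M0.filter fun e => cH e = b).biUnion id ⊆ M0.biUnion id := fun b =>
      biUnion_subset_biUnion_of_subset_left _ (filter_subset _ _)
    have d3 : M3.biUnion id ⊆ W1 := by
      rw [biUnion_subset]; exact hM3
    have d4 : M4.biUnion id ⊆ W1 \ M3.biUnion id := by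
      rw [biUnion_subset]; exact hM4
    have d12 : Disjoint ((M0.filter fun e => cH e = true).biUnion id)
        ((M0.filter fun e => cH e = false).biUnion id) := by
      rw [disjoint_biUnion_left]
      intro e he
      rw [disjoint_biUnion_right]
      intro f hf
      rw [mem_filter] at he hf
      refine hM0m e he.1 f hf.1 ?_
      rintro rfl
      rw [he.2] at hf; simp at hf
    have d0W : Disjoint (M0.biUnion id) W1 := disjoint_sdiff
    have d13 : ∀ b, Disjoint ((M0.filter fun e => cH e = b).biUnion id) (M3.biUnion id) :=
      fun b => (d0W.mono_left (d0 b)).mono_right d3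
    have d14 : ∀ b, Disjoint ((M0.filter fun e => cH e = b).biUnion id) (M4.biUnion id) :=
      fun b => (d0W.mono_left (d0 b)).mono_right (d4.trans sdiff_subset)
    have d34 : Disjoint (M3.biUnion id) (M4.biUnion id) := disjoint_sdiff.mono_right d4
    refine assemble H cH L _ _ M3 M4 true false b3 b4 (hTb true) (hTb false) hT3 hT4 d12
      (d13 _) (d14 _) (d13 _) (d14 _) d34 _ hcard ?_
    intro x k0 k1 k2 k3
    rw [mem_sdiff, mem_sdiff, hW1, mem_sdiff]
    refine ⟨⟨⟨mem_univ _, fun h => ?_⟩, k2⟩, k3⟩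
    obtain ⟨e, he, hxe⟩ := mem_biUnion.1 h
    cases hce : cH e
    · exact k1 (mem_biUnion.2 ⟨e, mem_filter.2 ⟨he, hce⟩, hxe⟩)
    · exact k0 (mem_biUnion.2 ⟨e, mem_filter.2 ⟨he, hce⟩, hxe⟩)
  have hempty : ∀ b, IsTCMatching 5 (H.filter (fun f => cH f = b)) ∅ := fun b =>
    ⟨empty_subset _, by simp [IsMatching], by simp⟩
  by_cases hc1 : (W1.card : ℝ) ≤ L
  · exact ⟨∅, ∅, true, true, by simp, by simp, hempty _, hempty _, by simpa using hc1⟩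
  push Not at hc1
  obtain ⟨t, ht⟩ : ∃ t : Finset V → Bool, t = fun S => if F3 S = Lab (c3 S) then c3 S else !(c3 S) :=
    ⟨_, rfl⟩
  have hsubK : ∀ {e S : Finset V}, e ∈ K → S ⊆ e → S ∈ K := fun he hS => hK.2.1 _ he _ hS
  have hstep : ∀ e ∈ K, e.card = 5 → e ⊆ W1 → ∀ S S', S ⊆ e → S' ⊆ e → S.card = 3 → S'.card = 3 →
      (S ∩ S').card + 1 = 3 → t S = t S' := by
    intro e he hec heW S S' hS hS' hSc hSc' hI
    have hSK := hsubK he hS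
    have hSK' := hsubK he hS'
    have hsame : c3 S = c3 S' → F3 S = F3 S' := fun hc =>
      h3 S hSK S' hSK' hSc hSc' (S ∩ S') inter_subset_left inter_subset_right hI hc
    by_cases hcc : c3 S = c3 S'
    · simp only [ht, hsame hcc, hcc]
    · have hcc' : c3 S' = !(c3 S) := b_ne _ _ hcc
      by_cases g : F3 S = Lab (c3 S) <;> by_cases g' : F3 S' = Lab (c3 S')
      · exfalso
        by_cases hce : cH e = c3 S
        · exact hno e he hec heW (by rw [h53 S hSK e he hSc hec hS hce, g, hce])
        · have hce' : cH e = c3 S' := b_tri _ _ _ hcc' hce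
          exact hno e he hec heW (by rw [h53 S' hSK' e he hSc' hec hS' hce', g', hce'])
      · simp only [ht]; rw [if_pos g, if_neg g', hcc', Bool.not_not]
      · simp only [ht]; rw [if_neg g, if_pos g', hcc']
      · exfalso
        have hpos : 0 < (S ∩ S').card := by omega
        obtain ⟨v, hv⟩ := card_pos.1 hpos
        rw [mem_inter] at hv
        have hvS : {v} ⊆ S := singleton_subset_iff.2 hv.1
        have hvS' : {v} ⊆ S' := singleton_subset_iff.2 hv.2
        have hvK := hsubK hSK hvS
        by_cases hcv : c3 S = c1 {v}
        · apply g
          rw [h31 {v} hvK S hSK (card_singleton _) hSc hvS hcv]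
          exact hLab _ v hvK hcv.symm
        · have hcv' : c3 S' = c1 {v} := hcc'.trans (b_ne _ _ hcv).symm
          apply g'
          rw [h31 {v} hvK S' hSK' (card_singleton _) hSc' hvS' hcv']
          exact hLab _ v hvK hcv'.symm
  have hall : ∀ e ∈ K, e.card = 5 → e ⊆ W1 → ∀ S S', S ⊆ e → S' ⊆ e → S.card = 3 → S'.card = 3 →
      t S = t S' := by
    intro e he hec heW S S' hS hS' hSc hSc'
    refine johnson e 3 (fun T => t S = t T) ?_ S' hS' hSc' _ S rfl hS hSc rfl
    intro A B hA hB hAc hBc hI h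
    exact h.trans (hstep e he hec heW A B hA hB hAc hBc hI)
  obtain ⟨e0, he0, he0W, he0c⟩ := greedy K δ hK W1 (by linarith) 5 le_rfl
  obtain ⟨T0, hT0, hT0c⟩ := exists_subset_card_eq (show 3 ≤ e0.card by omega)
  have htype : ∀ e ∈ K, e.card = 5 → e ⊆ W1 → ∀ S, S ⊆ e → S.card = 3 → t S = t T0 := by
    intro e he hec heW
    refine conn K δ hK W1 (by linarith) (fun e => ∀ S, S ⊆ e → S.card = 3 → t S = t T0) ?_
      _ e0 e le_rfl he0 he he0W heW he0c hec ?_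
    · intro e he e' he' heW heW' hec hec' hI h S hS hSc
      obtain ⟨T, hT, hTc⟩ := exists_subset_card_eq (show 3 ≤ (e ∩ e').card by omega)
      rw [← h T (hT.trans inter_subset_left) hTc]
      exact hall e' he' hec' heW' S T hS (hT.trans inter_subset_right) hSc hTc
    · intro S hS hSc
      exact hall e0 he0 he0c he0W S T0 hS hT0 hSc hT0c
  obtain ⟨t0, ht0⟩ : ∃ b, b = t T0 := ⟨_, rfl⟩
  rw [← ht0] at htype
  have hnb : ∀ b : Bool, b ≠ t0 → b = !t0 := by exact fun b h => b_ne _ _ (Ne.symm h)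
  have hstar : ∀ e ∈ K, e.card = 5 → e ⊆ W1 → ∀ S, S ⊆ e → S.card = 3 → c3 S = t0 → cH e = !t0 := by
    intro e he hec heW S hS hSc hc
    apply hnb
    intro hce
    have htS := htype e he hec heW S hS hSc
    have hg : F3 S = Lab (c3 S) := by
      by_contra hg
      simp only [ht, hg, if_false] at htS
      rw [hc] at htS
      exact Bool.not_ne_self t0 htS
    exact hno e he hec heW (by rw [h53 S (hsubK he hS) e he hSc hec hS (by rw [hce, hc]), hg, hc, hce])
  set PD : α → Finset V → Prop := fun D e => (cH e = (!t0) → F5 e = D) ∧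
    ∀ S, S ⊆ e → S.card = 3 → c3 S = (!t0) → F3 S = D with hPD
  have hwd : ∀ e ∈ K, e.card = 5 → e ⊆ W1 → ∃ D, PD D e := by
    intro e he hec heW
    by_cases hce : cH e = !t0
    · refine ⟨F5 e, fun _ => rfl, fun S hS hSc hc => ?_⟩
      exact (h53 S (hsubK he hS) e he hSc hec hS (by rw [hce, hc])).symm
    · obtain ⟨T, hT, hTc⟩ := exists_subset_card_eq (show 3 ≤ e.card by omega)
      refine ⟨F3 T, fun h => absurd h hce, fun S hS hSc hc => ?_⟩
      have hcol : ∀ S, S ⊆ e → S.card = 3 → c3 S = !t0 := fun S hS hSc =>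
        hnb _ (fun h => hce (hstar e he hec heW S hS hSc h))
      refine johnson e 3 (fun A => F3 A = F3 T) ?_ S hS hSc _ T rfl hT hTc rfl
      intro A B hA hB hAc hBc hI h
      rw [← h]
      exact h3 B (hsubK he hB) A (hsubK he hA) hBc hAc (A ∩ B) inter_subset_right inter_subset_left hI
        (by rw [hcol A hA hAc, hcol B hB hBc])
  obtain ⟨D, hD0⟩ := hwd e0 he0 he0c he0W
  have hD : ∀ e ∈ K, e.card = 5 → e ⊆ W1 → PD D e := by
    intro e he hec heW
    refine conn K δ hK W1 (by linarith) (PD D) ?_ _ e0 e le_rfl he0 he he0W heW he0c hec hD0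
    intro e he e' he' heW heW' hec hec' hI h
    obtain ⟨D', hD'⟩ := hwd e' he' hec' heW'
    have : D = D' := by
      by_cases hS : ∃ S, S ⊆ e ∩ e' ∧ S.card = 3 ∧ c3 S = !t0
      · obtain ⟨S, hS, hSc, hc⟩ := hS
        rw [← h.2 S (hS.trans inter_subset_left) hSc hc,
          ← hD'.2 S (hS.trans inter_subset_right) hSc hc]
      · push Not at hS
        obtain ⟨T, hT, hTc⟩ := exists_subset_card_eq (show 3 ≤ (e ∩ e').card by omega)
        have hcT : c3 T = t0 := by
          by_contra hh
          exact hS T hT hTc (hnb _ hh)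
        have k1 := hstar e he hec heW T (hT.trans inter_subset_left) hTc hcT
        have k2 := hstar e' he' hec' heW' T (hT.trans inter_subset_right) hTc hcT
        rw [← h.1 k1, ← hD'.1 k2]
        exact h5 e he e' he' hec hec' (e ∩ e') inter_subset_left inter_subset_right (by omega)
          (by rw [k1, k2])
    rw [this]; exact hD'
  obtain ⟨M3, hM3, hM3m, hM3x⟩ := maxmatch {e | e ∈ K ∧ e.card = 5 ∧ cH e = !t0} W1
  have hT3 : IsTCMatching 5 (H.filter (fun f => cH f = !t0)) M3 := by
    refine ⟨?_, hM3m, ?_⟩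
    · intro e he
      have := (hM3 e he).1
      exact mem_filter.2 ⟨hKH e this.1 this.2.1, this.2.2⟩
    · intro e he f hf
      obtain ⟨⟨a1, a2, a3⟩, a4⟩ := hM3 e he
      obtain ⟨⟨b1, b2, b3⟩, b4⟩ := hM3 f hf
      have := hF5 e a1 f b1 a2 b2 (a3.trans b3.symm)
        (by rw [(hD e a1 a2 a4).1 a3, (hD f b1 b2 b4).1 b3])
      rwa [a3] at this
  by_cases hc2 : ((W1 \ M3.biUnion id).card : ℝ) ≤ L
  · exact ⟨M3, ∅, !t0, true, fun e he => (hM3 e he).2, by simp, hT3, hempty _, by simpa using hc2⟩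
  push Not at hc2
  set W2 := W1 \ M3.biUnion id with hW2
  have hcol : ∀ e ∈ K, e.card = 5 → e ⊆ W2 → cH e = t0 := by
    intro e he hec heW
    by_contra hh
    have := hM3x e ⟨he, hec, hnb _ hh⟩ heW
    rw [this] at hec
    simp at hec
  obtain ⟨M4, hM4, hM4m, hM4x⟩ := maxmatch {e | e ∈ K ∧ e.card = 5} W2
  refine ⟨M3, M4, !t0, t0, fun e he => (hM3 e he).2, fun e he => (hM4 e he).2, hT3,
    ⟨?_, hM4m, ?_⟩, ?_⟩
  · intro e he
    obtain ⟨⟨a1, a2⟩, a4⟩ := hM4 e he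
    exact mem_filter.2 ⟨hKH e a1 a2, hcol e a1 a2 a4⟩
  · intro e he f hf
    obtain ⟨⟨a1, a2⟩, a4⟩ := hM4 e he
    obtain ⟨⟨b1, b2⟩, b4⟩ := hM4 f hf
    refine conn K δ hK W2 (by linarith)
      (fun g => TightConn 5 (H.filter (fun f => cH f = t0)) g f) ?_ _ f e le_rfl b1 a1 b4 a4 b2 a2
      (tc_refl _ _ _ (mem_filter.2 ⟨hKH f b1 b2, hcol f b1 b2 b4⟩))
    intro g hg g' hg' hgW hgW' hgc hgc' hI h
    exact tc_cons _ _ g' g f (mem_filter.2 ⟨hKH g' hg' hgc', hcol g' hg' hgc' hgW'⟩)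
      (by rw [inter_comm, hI]) h
  · by_contra hcon
    push Not at hcon
    obtain ⟨e, he, heW, hec⟩ := greedy K δ hK (W2 \ M4.biUnion id) (by linarith) 5 le_rfl
    have := hM4x e ⟨he, hec⟩ heW
    rw [this] at hec
    simp at hec


lemma choose_ratio (m n j : ℕ) (hmn : m ≤ n) (hj : 1 ≤ j) :
    m.choose j * n ≤ m * n.choose j := by
  obtain ⟨j, rfl⟩ : ∃ i, j = i + 1 := ⟨j - 1, by omega⟩
  rcases Nat.eq_zero_or_pos m with rfl | hm
  · simp
  obtain ⟨m, rfl⟩ : ∃ i, m = i + 1 := ⟨m - 1, by omega⟩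
  obtain ⟨n, rfl⟩ : ∃ i, n = i + 1 := ⟨n - 1, by omega⟩
  have a := Nat.add_one_mul_choose_eq m j
  have b := Nat.add_one_mul_choose_eq n j
  have c : m.choose j ≤ n.choose j := Nat.choose_le_choose j (by omega)
  have : ((m + 1).choose (j + 1) * (n + 1)) * (j + 1) ≤ ((m + 1) * (n + 1).choose (j + 1)) * (j + 1) := by
    calc _ = ((m+1) * m.choose j) * (n+1) := by rw [a]; ring
      _ ≤ ((m+1) * n.choose j) * (n+1) := by gcongr
      _ = (m+1) * ((n+1) * n.choose j) := by ring
      _ = _ := by rw [b]; ring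
  exact Nat.le_of_mul_le_mul_right this (by omega)

lemma deg_zero_of (H : Finset (Finset V)) (v : V) (h : ∀ e ∈ H, v ∉ e) : degT 5 H {v} = 0 := by
  unfold degT degOn
  rw [card_eq_zero, filter_eq_empty_iff]
  intro e _ he
  exact h _ he (by simp)

lemma single_count (H : Finset (Finset V)) (ε α : ℝ) (hd : IsDense 5 H (1 - ε) α) (hε : ε < 1)
    (hn : 5 ≤ Fintype.card V) :
    ((univ.filter fun v : V => ∀ e ∈ H, v ∉ e).card : ℝ) ≤ α * Fintype.card V := by
  have h := (hd 1 le_rfl (by norm_num)).1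
  rw [Nat.choose_one_right] at h
  refine le_trans ?_ h
  rw [Nat.cast_le, ← Set.ncard_coe_finset]
  refine Set.ncard_le_ncard_of_injOn (fun v => ({v} : Finset V)) ?_ ?_ ?_
  · intro v hv
    rw [mem_coe, mem_filter] at hv
    refine ⟨card_singleton v, ?_⟩
    rw [deg_zero_of H v hv.2]
    have : 0 < (Fintype.card V).choose (5 - 1) := Nat.choose_pos (by omega)
    have : (0 : ℝ) < ((Fintype.card V).choose (5 - 1) : ℕ) := by exact_mod_cast this
    rw [Nat.cast_zero]
    exact mul_pos (by linarith) this
  · intro a _ b _ hab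
    exact singleton_injective hab
  · exact Set.toFinite _

lemma init_cx (H : Finset (Finset V)) (K : Set (Finset V))
    (hm : ∀ S, S ∈ K ↔ ∃ e ∈ H, S ⊆ e) (ε α δ : ℝ) (h5 : ∀ e ∈ H, e.card = 5)
    (hd : IsDense 5 H (1 - ε) α) (hε : ε < 1) (hα : α < 1)
    (hεδ : ε ≤ δ) (hαδ : α ≤ δ) (hn : 5 ≤ Fintype.card V) :
    Cx K δ := by
  have hnR : (0 : ℝ) < Fintype.card V := by
    have : 0 < Fintype.card V := by omega
    exact_mod_cast this
  have hs := single_count H ε α hd hε hn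
  refine ⟨?_, ?_, ?_⟩
  · by_contra hcon
    have hH : ∀ e, e ∉ H := fun e he => hcon ((hm _).2 ⟨e, he, empty_subset _⟩)
    have : (univ.filter fun v : V => ∀ e ∈ H, v ∉ e) = univ := by
      rw [filter_eq_self]
      intro v _ e he
      exact absurd he (hH e)
    rw [this, card_univ] at hs
    nlinarith
  · intro S hSK T hT
    obtain ⟨e, he, hS⟩ := (hm _).1 hSK
    exact (hm _).2 ⟨e, he, hT.trans hS⟩
  · intro S hSK hSc
    obtain ⟨e0, he0, hS0⟩ := (hm _).1 hSK
    rcases Nat.eq_zero_or_pos S.card with h0 | hpos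
    · rw [card_eq_zero] at h0
      subst h0
      refine le_trans ?_ (hs.trans (mul_le_mul_of_nonneg_right hαδ hnR.le))
      norm_cast
      apply card_le_card
      intro v hv
      rw [mem_filter] at hv ⊢
      refine ⟨mem_univ _, fun e he hve => hv.2 ((hm _).2 ⟨e, he, ?_⟩)⟩
      intro x hx
      simp at hx
      rwa [hx]
    · set B := univ.filter fun v => insert v S ∉ K with hB
      have hdeg : degT 5 H S ≠ 0 := by
        unfold degT degOn
        rw [← Nat.pos_iff_ne_zero, card_pos]
        refine ⟨e0 \ S, mem_filter.2 ⟨mem_powersetCard.2 ⟨subset_univ _, ?_⟩, ?_⟩⟩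
        · rw [card_sdiff_of_subset hS0, h5 e0 he0]
        · rwa [sdiff_union_of_subset hS0]
      have hge : (1 - ε) * ((Fintype.card V).choose (5 - S.card) : ℝ) ≤ degT 5 H S := by
        by_contra hlt
        push Not at hlt
        exact hdeg ((hd S.card hpos (by omega)).2 S rfl hlt)
      have hle : degT 5 H S ≤ (univ \ B).card.choose (5 - S.card) := by
        unfold degT degOn
        rw [← card_powersetCard]
        apply card_le_card
        intro e he
        rw [mem_filter, mem_powersetCard] at he
        rw [mem_powersetCard]
        refine ⟨fun x hx => ?_, he.1.2⟩
        rw [mem_sdiff, hB, mem_filter]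
        refine ⟨mem_univ _, fun hxB => hxB.2 ((hm _).2 ⟨_, he.2, ?_⟩)⟩
        exact insert_subset (mem_union_left _ hx) subset_union_right
      have hcard : (univ \ B).card + B.card = Fintype.card V := by
        rw [card_sdiff_add_card_eq_card (subset_univ _), card_univ]
      have hr := choose_ratio (univ \ B).card (Fintype.card V) (5 - S.card) (by omega) (by omega)
      have hc0 : 0 < (Fintype.card V).choose (5 - S.card) := Nat.choose_pos (by omega)
      have hc0R : (0 : ℝ) < ((Fintype.card V).choose (5 - S.card) : ℕ) := by exact_mod_cast hc0
      have hrR : (((univ \ B).card.choose (5 - S.card) : ℕ) : ℝ) * Fintype.card V ≤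
        ((univ \ B).card : ℝ) * ((Fintype.card V).choose (5 - S.card) : ℕ) := by exact_mod_cast hr
      have hleR : (degT 5 H S : ℝ) ≤ ((univ \ B).card.choose (5 - S.card) : ℕ) := by
        exact_mod_cast hle
      have hcR : ((univ \ B).card : ℝ) + B.card = Fintype.card V := by exact_mod_cast hcard
      have h1 : (1 - ε) * ((Fintype.card V).choose (5 - S.card) : ℕ) * Fintype.card V ≤
          ((univ \ B).card : ℝ) * ((Fintype.card V).choose (5 - S.card) : ℕ) :=
        (mul_le_mul_of_nonneg_right (hge.trans hleR) hnR.le).trans hrR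
      have h2 : (1 - ε) * (Fintype.card V : ℝ) ≤ (univ \ B).card := by
        refine le_of_mul_le_mul_right ?_ hc0R
        linarith
      have h3 : (B.card : ℝ) ≤ ε * Fintype.card V := by linarith
      exact h3.trans (mul_le_mul_of_nonneg_right hεδ hnR.le)

lemma Cx_mono (K : Set (Finset V)) (δ δ' : ℝ) (h : δ ≤ δ') (hK : Cx K δ) : Cx K δ' :=
  ⟨hK.1, hK.2.1, fun S hS hc => (hK.2.2 S hS hc).trans
    (mul_le_mul_of_nonneg_right h (Nat.cast_nonneg _))⟩

lemma AdjOK_mono {α : Type*} (K K' : Set (Finset V)) (h : K' ⊆ K) (k : ℕ) (c : Finset V → Bool)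
    (F : Finset V → α) (hK : AdjOK K k c F) : AdjOK K' k c F :=
  fun e he e' he' => hK e (h he) e' (h he')

lemma adj_init (H : Finset (Finset V)) (cH : Finset V → Bool) (K : Set (Finset V))
    (hKH : ∀ e ∈ K, e.card = 5 → e ∈ H) :
    ∃ F : Finset V → Finset (Finset V), AdjOK K 5 cH F ∧
      ∀ e ∈ K, ∀ e' ∈ K, e.card = 5 → e'.card = 5 → cH e = cH e' → F e = F e' →
      TightConn 5 (H.filter (fun f => cH f = cH e)) e e' := by
  refine ⟨fun e => (H.filter (fun f => cH f = cH e)).filter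
    (fun g => TightConn 5 (H.filter (fun f => cH f = cH e)) e g), ?_, ?_⟩
  · intro e he e' he' hec hec' p hp hp' hpc hc
    by_cases hee : e = e'
    · rw [hee]
    have hI : (e ∩ e').card = 4 := by
      have h1 : p.card ≤ (e ∩ e').card := card_le_card (subset_inter hp hp')
      have h2 : (e ∩ e').card ≤ e.card := card_le_card inter_subset_left
      have h3 : (e ∩ e').card ≠ 5 := by
        intro h
        apply hee
        have a := eq_of_subset_of_card_le (inter_subset_left : e ∩ e' ⊆ e) (by omega)
        have b := eq_of_subset_of_card_le (inter_subset_right : e ∩ e' ⊆ e') (by omega)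
        exact a.symm.trans b
      omega
    have m1 : e ∈ H.filter (fun f => cH f = cH e) := mem_filter.2 ⟨hKH e he hec, rfl⟩
    have m2 : e' ∈ H.filter (fun f => cH f = cH e) := mem_filter.2 ⟨hKH e' he' hec', hc.symm⟩
    show (H.filter (fun f => cH f = cH e)).filter
        (fun g => TightConn 5 (H.filter (fun f => cH f = cH e)) e g) =
      (H.filter (fun f => cH f = cH e')).filter
        (fun g => TightConn 5 (H.filter (fun f => cH f = cH e')) e' g)
    rw [← hc]
    apply filter_congr
    intro g _
    constructor
    · exact tc_cons 5 _ e' e g m2 (by rw [inter_comm, hI])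
    · exact tc_cons 5 _ e e' g m1 (by rw [hI])
  · intro e he e' he' hec hec' hc hF
    have m2 : e' ∈ H.filter (fun f => cH f = cH e') := mem_filter.2 ⟨hKH e' he' hec', rfl⟩
    have : e' ∈ (H.filter (fun f => cH f = cH e')).filter
        (fun g => TightConn 5 (H.filter (fun f => cH f = cH e')) e' g) :=
      mem_filter.2 ⟨m2, tc_refl 5 _ _ m2⟩
    have hF' : (H.filter (fun f => cH f = cH e)).filter
        (fun g => TightConn 5 (H.filter (fun f => cH f = cH e)) e g) =
      (H.filter (fun f => cH f = cH e')).filter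
        (fun g => TightConn 5 (H.filter (fun f => cH f = cH e')) e' g) := hF
    rw [← hF'] at this
    exact (mem_filter.1 this).2

lemma consts (β : ℝ) (hβ : 0 < β) (hβ1 : β ≤ 1 / 10) : ∃ δ θ θ' : ℝ, 0 < δ ∧ 0 < θ ∧ 0 < θ' ∧
    δ ≤ 1 / 10 ∧ θ ≤ 1 ∧ θ' ≤ 1 ∧ 256 * (3 * δ) < θ ^ 4 ∧ 256 * (4 * (δ + 16 * θ)) < θ' ^ 4 ∧
    δ + 16 * θ + 16 * θ' ≤ β := by
  have e1 : 0 < (β / 64) ^ 4 := by positivity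
  have e2 : (β / 64) ^ 4 ≤ β / 64 :=
    pow_le_of_le_one (by positivity) (by linarith) (by norm_num)
  set q := (β / 64) ^ 4 with hq
  have e3 : 0 < (q / 100000) ^ 4 := by positivity
  have e4 : (q / 100000) ^ 4 ≤ q / 100000 :=
    pow_le_of_le_one (by positivity) (by linarith) (by norm_num)
  set r := (q / 100000) ^ 4 with hr
  refine ⟨r / 1000, q / 100000, β / 64, by positivity, by positivity, by positivity,
    by linarith, by linarith, by linarith, ?_, ?_, by linarith⟩
  · rw [← hr]; linarith
  · rw [← hq]; linarith

end aux

/-- For every `0 < η < 1` there is `α₀ > 0` such that for every `0 < α ≤ α₀` there is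
`ε₀ > 0` such that for every `0 < ε ≤ ε₀` there is `n₀` such that for all `n ≥ n₀`: every
2-edge-coloured `(1-ε, α)`-dense 5-graph `H` on `n` vertices contains four monochromatic
tightly connected matchings, pairwise vertex-disjoint, together covering all but at most
`3ηn` vertices. -/
theorem stmt18 (η : ℝ) (hη0 : 0 < η) (hη1 : η < 1) :
    ∃ α₀ : ℝ, 0 < α₀ ∧ ∀ α : ℝ, 0 < α → α ≤ α₀ →
      ∃ ε₀ : ℝ, 0 < ε₀ ∧ ∀ ε : ℝ, 0 < ε → ε ≤ ε₀ →
        ∃ n₀ : ℕ, ∀ n : ℕ, n₀ ≤ n →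
          ∀ (H : Finset (Finset (Fin n))) (cH : Finset (Fin n) → Bool),
            (∀ e ∈ H, e.card = 5) → IsDense 5 H (1 - ε) α →
            ∃ (M : Fin 4 → Finset (Finset (Fin n))) (b : Fin 4 → Bool),
              (∀ i, IsTCMatching 5 (H.filter (fun f => cH f = b i)) (M i)) ∧
              (∀ i j, i ≠ j → Disjoint ((M i).biUnion id) ((M j).biUnion id)) ∧
              (n : ℝ) - 3 * η * n ≤
                (((Finset.univ : Finset (Fin 4)).biUnion
                    (fun i => (M i).biUnion id)).card : ℝ) := by
  obtain ⟨δ₂, θ₂, θ₂', p1, p2, p3, p4, p5, p6, p7, p8, p9⟩ :=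
    consts (η / 10) (by positivity) (by linarith)
  obtain ⟨δ₁, θ₁, θ₁', q1, q2, q3, q4, q5, q6, q7, q8, q9⟩ := consts δ₂ p1 p4
  refine ⟨δ₁, q1, fun α hα0 hα => ⟨δ₁, q1, fun ε hε0 hε => ?_⟩⟩
  refine ⟨max 5 (⌈max (1 / δ₁) (10 / η)⌉₊), fun n hn H cH h5 hd => ?_⟩
  have hn5 : 5 ≤ n := (le_max_left _ _).trans hn
  have hnc : max (1 / δ₁) (10 / η) ≤ (n : ℝ) :=
    (Nat.le_ceil _).trans (by exact_mod_cast (le_max_right _ _).trans hn)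
  have hn1 : 1 ≤ δ₁ * n := by
    have := (le_max_left _ _).trans hnc
    rw [div_le_iff₀ q1] at this
    linarith
  have hn2 : 10 ≤ η * n := by
    have := (le_max_right _ _).trans hnc
    rw [div_le_iff₀ hη0] at this
    linarith
  have hδ12 : δ₁ ≤ δ₂ := by linarith
  have hn0 : (0 : ℝ) ≤ n := Nat.cast_nonneg _
  have hn1' : 1 ≤ δ₂ * n := hn1.trans (mul_le_mul_of_nonneg_right hδ12 hn0)
  have hK := init_cx H {S | ∃ e ∈ H, S ⊆ e} (fun S => Iff.rfl) ε α δ₁ h5 hd (by linarith) (by linarith) hε hα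
    (by rw [Fintype.card_fin]; exact hn5)
  set K : Set (Finset (Fin n)) := {S | ∃ e ∈ H, S ⊆ e} with hKdef
  have hKH : ∀ e ∈ K, e.card = 5 → e ∈ H := by
    rintro e ⟨f, hf, hef⟩ hec
    rw [eq_of_subset_of_card_le hef (by rw [h5 f hf, hec])]
    exact hf
  obtain ⟨F5, hA5, hF5⟩ := adj_init H cH K hKH
  obtain ⟨K', c3, F3, hK'K, hK', hA3, h53⟩ := blueprint K δ₁ θ₁ θ₁' hK 3 (by norm_num) le_rfl
    cH F5 hA5 q4 (by rw [Fintype.card_fin]; exact hn1) q1 q2 q5 q3 q6 q7 q8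
  obtain ⟨K'', c1, F1, hK''K, hK'', hA1, h31⟩ := blueprint K' δ₂ θ₂ θ₂' (Cx_mono _ _ _ q9 hK') 1
    le_rfl (by norm_num) c3 F3 hA3 p4 (by rw [Fintype.card_fin]; exact hn1') p1 p2 p5 p3 p6 p7 p8
  have hs := hK''K.trans hK'K
  have := core H cH K'' (η / 10) (3 * η * n) (by positivity) (Cx_mono _ _ _ p9 hK'') F5 F3 F1 c3 c1
    (fun e he e' he' => hF5 e (hs he) e' (hs he')) (fun e he => hKH e (hs he))
    (AdjOK_mono _ _ hs _ _ _ hA5) (AdjOK_mono _ _ hK''K _ _ _ hA3) hA1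
    (fun S hS e he => h53 S (hK''K hS) e (hK''K he)) h31
    (by rw [Fintype.card_fin]; nlinarith)
  rw [Fintype.card_fin] at this
  convert this
end
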